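/- The number of isomorphism classes of left braces $(B,+,\cdot)$ with additive group $(B,+)$ isomorphic to $C_2\times C_2\times C_4\times C_4$ and multiplicative group $(B,\cdot)$ isomorphic to $C_2\times C_2\times C_2\times C_2\times C_4$ is $978$. -/

import Mathlib

/-- A left brace structure on a set `B`: an abelian group operation `+` (with
zero element `zero` and negation `neg`), a group operation `*` (with identity
`one` and inversion `inv`), linked by the relation
`x * (y + z) = x * y - x + x * z`, i.e. `x * (y + z) = (x * y + (-x)) + x * z`. -/
structure LeftBrace (B : Type*) where
  add : B → B → B
  zero : B
  neg : B → B
  mul : B → B → B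
  one : B
  inv : B → B
  add_assoc : ∀ a b c, add (add a b) c = add a (add b c)
  add_comm : ∀ a b, add a b = add b a
  zero_add : ∀ a, add zero a = a
  neg_add_cancel : ∀ a, add (neg a) a = zero
  mul_assoc : ∀ a b c, mul (mul a b) c = mul a (mul b c)
  one_mul : ∀ a, mul one a = a
  mul_one : ∀ a, mul a one = a
  inv_mul_cancel : ∀ a, mul (inv a) a = one
  brace : ∀ x y z, mul x (add y z) = add (add (mul x y) (neg x)) (mul x z)

/-- Two left braces are isomorphic if there is a bijection preserving both
operations. -/
def LeftBrace.Iso {B₁ B₂ : Type*} (L₁ : LeftBrace B₁) (L₂ : LeftBrace B₂) : Prop :=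
  ∃ e : B₁ ≃ B₂, (∀ x y, e (L₁.add x y) = L₂.add (e x) (e y)) ∧
    (∀ x y, e (L₁.mul x y) = L₂.mul (e x) (e y))

/-- The additive group of the left brace `L` is isomorphic to the
(additively written) abelian group `A`. -/
def LeftBrace.AddIso {B : Type*} (L : LeftBrace B) (A : Type*) [AddGroup A] : Prop :=
  ∃ e : B ≃ A, ∀ x y, e (L.add x y) = e x + e y

/-- The multiplicative group of the left brace `L` is isomorphic to the
(additively written) group `A`. -/
def LeftBrace.MulIso {B : Type*} (L : LeftBrace B) (A : Type*) [AddGroup A] : Prop :=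
  ∃ e : B ≃ A, ∀ x y, e (L.mul x y) = e x + e y

namespace BR
noncomputable section
def frc {β : Type} (n : ℕ) (k : ℕ → β) : β := Nat.rec (k 0) (fun m _ => k (Nat.succ m)) n
def bt (b n : ℕ) : ℕ := Nat.land (Nat.shiftRight b n) 1
structure GP where
  (tb db fb p q r s x y z w P Q R S ex : ℕ)
structure EF where
  (tb P Q R S c2 c3 : ℕ)
def lk6 (tb b : ℕ) : ℕ := Nat.land (Nat.shiftRight tb (Nat.mul 6 b)) 63
def lk4 (tb b : ℕ) : ℕ := Nat.land (Nat.shiftRight tb (Nat.mul 4 b)) 15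
def enc6 (a b c d e f : ℕ) : ℕ := Nat.add a (Nat.mul 2 (Nat.add b (Nat.mul 2 (Nat.add c (Nat.mul 2 (Nat.add d (Nat.mul 2 (Nat.add e (Nat.mul 2 f)))))))))
def enc4 (a b c d : ℕ) : ℕ := Nat.add a (Nat.mul 2 (Nat.add b (Nat.mul 2 (Nat.add c (Nat.mul 2 d)))))
def mk (w : ℕ) (f : ℕ → ℕ) (n : ℕ) : ℕ := Nat.rec 0 (fun m ih => Nat.add ih (Nat.shiftLeft (f m) (Nat.mul w m))) n
def mn (a b c d : ℕ) : ℕ := Nat.mod (Nat.add (Nat.mul a d) (Nat.mul b c)) 2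
def minor (u v k l : ℕ) : ℕ := mn (bt u k) (bt u l) (bt v k) (bt v l)
def col (a b c d k l : ℕ) : ℕ := enc6 (minor a b k l) (minor a c k l) (minor a d k l) (minor b c k l) (minor b d k l) (minor c d k l)
def dcol (a b c d k : ℕ) : ℕ := enc6 (Nat.mul (bt a k) (bt b k)) (Nat.mul (bt a k) (bt c k)) (Nat.mul (bt a k) (bt d k)) (Nat.mul (bt b k) (bt c k)) (Nat.mul (bt b k) (bt d k)) (Nat.mul (bt c k) (bt d k))
def fcol (a b c d k : ℕ) : ℕ := enc4 (bt a k) (bt b k) (bt c k) (bt d k)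
def lin6 (c0 c1 c2 c3 c4 c5 b : ℕ) : ℕ :=
  Nat.xor (Nat.mul (bt b 0) c0) (Nat.xor (Nat.mul (bt b 1) c1) (Nat.xor (Nat.mul (bt b 2) c2) (Nat.xor (Nat.mul (bt b 3) c3) (Nat.xor (Nat.mul (bt b 4) c4) (Nat.mul (bt b 5) c5)))))
def lin4 (c0 c1 c2 c3 b : ℕ) : ℕ :=
  Nat.xor (Nat.mul (bt b 0) c0) (Nat.xor (Nat.mul (bt b 1) c1) (Nat.xor (Nat.mul (bt b 2) c2) (Nat.mul (bt b 3) c3)))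
def mkTB (a b c d : ℕ) : ℕ :=
  frc (col a b c d 0 1) fun c0 => frc (col a b c d 0 2) fun c1 => frc (col a b c d 0 3) fun c2 =>
  frc (col a b c d 1 2) fun c3 => frc (col a b c d 1 3) fun c4 => frc (col a b c d 2 3) fun c5 =>
  mk 6 (lin6 c0 c1 c2 c3 c4 c5) 64
def mkDB (a b c d : ℕ) : ℕ :=
  frc (dcol a b c d 0) fun c0 => frc (dcol a b c d 1) fun c1 => frc (dcol a b c d 2) fun c2 =>
  frc (dcol a b c d 3) fun c3 => mk 6 (lin4 c0 c1 c2 c3) 16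
def mkFB (a b c d : ℕ) : ℕ :=
  frc (fcol a b c d 0) fun c0 => frc (fcol a b c d 1) fun c1 => frc (fcol a b c d 2) fun c2 =>
  frc (fcol a b c d 3) fun c3 => mk 4 (lin4 c0 c1 c2 c3) 16
def GLs : List (ℕ × ℕ × ℕ × ℕ) := [(1,0,0,1),(1,1,0,1),(1,0,1,1),(0,1,1,0),(1,1,1,0),(0,1,1,1)]
def Bt : List (ℕ × ℕ) := [(0,0),(0,1),(1,0),(1,1)]
def mkG (ep : ℕ) (E F : ℕ × ℕ × ℕ × ℕ) (K L : ℕ × ℕ) (XX : List ((ℕ × ℕ) × (ℕ × ℕ))) : List GP :=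
  match E, F, K, L with
  | (p,q,r,s), (P,Q,R,S), (k1,k2), (l1,l2) =>
  frc (enc4 s q 0 0) fun a => frc (enc4 r p 0 0) fun b =>
  frc (mn S Q l1 k1) fun u => frc (mn S Q l2 k2) fun v =>
  frc (mn R P l1 k1) fun u' => frc (mn R P l2 k2) fun v' =>
  frc (enc4 (mn u v r s) (mn u v p q) S Q) fun c =>
  frc (enc4 (mn u' v' r s) (mn u' v' p q) R P) fun d =>
  frc (mkTB a b c d) fun tb => frc (mkDB a b c d) fun db => frc (mkFB a b c d) fun fb =>
  XX.map fun X => match X with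
    | ((x,y),(z,w)) => frc (Nat.mul ep (enc6 0 0 (mn s q w y) 0 (mn r p w y) 0)) fun ex =>
      ⟨tb, db, fb, p,q,r,s,x,y,z,w,P,Q,R,S,ex⟩
def frcG {β : Type} (l : List GP) (k : List GP → β) : β :=
  List.rec (motive := fun _ => List GP → β) (fun acc => k acc)
    (fun a _ ih acc => GP.rec (fun tb db fb p q r s x y z w P Q R S ex => ih (⟨tb, db, fb, p,q,r,s,x,y,z,w,P,Q,R,S,ex⟩ :: acc)) a) l []
def mkT (ep : ℕ) (Es Fs : List (ℕ × ℕ × ℕ × ℕ)) (Ks : List (ℕ × ℕ)) (Xs : List (ℕ × ℕ)) : List GP :=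
  let XX := Xs.flatMap fun X => Bt.map fun Y => (X, Y)
  Es.flatMap fun E => Fs.flatMap fun F => Ks.flatMap fun K => Bt.flatMap fun L => mkG ep E F K L XX
def T8 : List GP := mkT 0 GLs [(1,0,0,1),(1,0,1,1)] Bt Bt
def T4 : List GP := mkT 1 GLs [(1,0,0,1),(1,0,1,1)] [(0,0)] Bt
def T1 : List GP := mkT 0 [(1,0,0,1),(1,0,1,1)] GLs Bt [(0,0)]

def cnd {β : Type} (b : Bool) (x y : β) : β := Bool.rec y x b
def xr (a b : ℕ) : ℕ := Nat.xor a b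
def sel {α : Type} (f : α → ℕ) (x : ℕ) (k : List α → List ℕ) (l : List α) : List ℕ :=
  List.rec (motive := fun _ => List α → List ℕ) (fun acc => k acc)
    (fun a _ ih acc => frc (f a) fun y => cnd (Nat.beq y x) (ih (a :: acc)) (cnd (Nat.ble x y) (ih acc) [])) l []
def aX (tb db b d : ℕ) : ℕ := xr (lk6 tb b) (lk6 db d)
def aB (b0 b1 d0 d1 : ℕ) (g : GP) : ℕ :=
  frc (aX g.tb g.db b0 d0) fun X0 => frc (aX g.tb g.db b1 d1) fun X1 =>
    Nat.add (Nat.mul 64 (xr (Nat.mul g.q X0) (Nat.mul g.s X1))) (xr (Nat.mul g.p X0) (Nat.mul g.r X1))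
def toE (b0 b1 d0 d1 d2 d3 : ℕ) (g : GP) : EF :=
  frc (aX g.tb g.db b0 d0) fun X0 => frc (aX g.tb g.db b1 d1) fun X1 =>
  frc (xr (lk6 g.db d2) g.ex) fun D2 => frc (lk6 g.db d3) fun D3 =>
  frc (xr (xr (Nat.mul g.x X0) (Nat.mul g.z X1)) (xr (Nat.mul g.P D2) (Nat.mul g.R D3))) fun c2 =>
  frc (xr (xr (Nat.mul g.y X0) (Nat.mul g.w X1)) (xr (Nat.mul g.Q D2) (Nat.mul g.S D3))) fun c3 =>
  ⟨g.tb, g.P, g.Q, g.R, g.S, c2, c3⟩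
def eqE (a b : EF) : Bool := and (Nat.beq a.c2 b.c2) (and (Nat.beq a.c3 b.c3) (and (Nat.beq a.tb b.tb)
  (and (Nat.beq a.P b.P) (and (Nat.beq a.Q b.Q) (and (Nat.beq a.R b.R) (Nat.beq a.S b.S))))))
def ins (a : EF) (l : List EF) : List EF := List.rec (a :: []) (fun b t _ => cnd (eqE a b) (b :: t) (a :: b :: t)) l
def dde (f : GP → EF) (l : List GP) (k : List EF → List ℕ) : List ℕ :=
  List.rec (motive := fun _ => List EF → List ℕ) (fun acc => k acc)
    (fun a _ ih acc => EF.rec (fun tb P Q R S c2 c3 => ih (ins ⟨tb,P,Q,R,S,c2,c3⟩ acc)) (f a)) l []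
def aE (b2 b3 : ℕ) (e : EF) : ℕ :=
  frc (lk6 e.tb b2) fun Y2 => frc (lk6 e.tb b3) fun Y3 =>
    Nat.add (Nat.mul 64 (xr (xr (Nat.mul e.Q Y2) (Nat.mul e.S Y3)) e.c3)) (xr (xr (Nat.mul e.P Y2) (Nat.mul e.R Y3)) e.c2)
def allE (f : EF → ℕ) (x : ℕ) (l : List EF) : Bool := List.rec true (fun a _ ih => cnd (Nat.ble x (f a)) ih false) l
def pk (b d : ℕ) : ℕ :=
  enc4 (enc4 (bt d 0) (bt b 0) (bt b 1) (bt b 2)) 0 0 0 |>.add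
  (Nat.mul 16 (enc4 (bt b 0) (bt d 1) (bt b 3) (bt b 4))) |>.add
  (Nat.mul 256 (enc4 (bt b 1) (bt b 3) (bt d 2) (bt b 5))) |>.add
  (Nat.mul 4096 (enc4 (bt b 2) (bt b 4) (bt b 5) (bt d 3)))
structure Ent where
  (b a s r0 r1 r2 t0 t1 t2 : ℕ)
def mkE {β : Type} (d b : ℕ) (k : Ent → β) : β :=
  frc (pk b d) fun a => frc (mk 4 (bt a) 16) fun s =>
  frc (Nat.land a 15) fun r0 => frc (Nat.land (Nat.shiftRight a 4) 15) fun r1 => frc (Nat.land (Nat.shiftRight a 8) 15) fun r2 =>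
  frc (mk 16 (bt r0) 4) fun t0 => frc (mk 16 (bt r1) 4) fun t1 => frc (mk 16 (bt r2) 4) fun t2 =>
  k ⟨b, a, s, r0, r1, r2, t0, t1, t2⟩
def tab {β : Type} (d : ℕ) (k : List Ent → β) : β :=
  Nat.rec (motive := fun _ => List Ent → β) (fun acc => k acc) (fun m ih acc => mkE d m fun E => ih (E :: acc)) 64 []
def lpE (l : List Ent) (k : Ent → List ℕ) : List ℕ := List.rec [] (fun E _ ih => List.append (k E) ih) l
def lpA (n : ℕ) (k : ℕ → List ℕ) : List ℕ := Nat.rec [] (fun m ih => List.append ih (k m)) n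
def asc (e e2 : ℕ) (E0 E1 Er E3 : Ent) : Bool := Nat.beq
  (xr (xr (Nat.mul E0.s Er.r0) (Nat.mul E1.s Er.r1)) (Nat.mul e (xr (Nat.mul 1152921504606846976 Er.r2) (Nat.mul e2 (Nat.mul 8 E3.s)))))
  (xr (xr (Nat.mul Er.t0 E0.a) (Nat.mul Er.t1 E1.a)) (Nat.mul e (xr (Nat.mul 32768 Er.t2) (Nat.mul e2 (Nat.mul 281474976710656 E3.a)))))
def key (f b g : ℕ) : ℕ := Nat.add (Nat.mul 4096 (Nat.add (Nat.mul 4096 f) b)) g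
def levG (e f b : ℕ) (E0 E1 : Ent) (L2 L3 : List Ent) (l : List EF) : List ℕ :=
  lpE L3 fun E3 => cnd (asc e 0 E0 E1 E3 E3)
    (lpE L2 fun E2 => cnd (asc e 1 E0 E1 E2 E3)
      (frc (Nat.add (Nat.mul 64 E3.b) E2.b) fun g => cnd (allE (aE E2.b E3.b) g l) [key f b g] []) []) []
def levB (e f d0 d1 d2 d3 : ℕ) (l : List GP) : List ℕ :=
  tab d0 fun L0 => tab d1 fun L1 => tab d2 fun L2 => tab d3 fun L3 =>
  lpE L1 fun E1 => lpE L0 fun E0 =>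
    cnd (and (asc e 0 E0 E1 E0 E0) (asc e 0 E0 E1 E1 E1))
      (frc (Nat.add (Nat.mul 64 E1.b) E0.b) fun b => sel (aB E0.b E1.b d0 d1) b (fun l2 => dde (toE E0.b E1.b d0 d1 d2 d3) l2 (levG e f b E0 E1 L2 L3)) l) []
def eng (e : ℕ) (okf : ℕ → Bool) (d0 d2 : ℕ → ℕ) (T : List GP) : List ℕ :=
  frcG T fun T => lpA 16 fun f => cnd (okf f) (sel (fun g => lk4 g.fb f) f (fun l => frc (d0 f) fun d0 => frc (d2 f) fun d2 => levB e f d0 0 d2 8 l) T) []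
def e8 : List ℕ := eng 0 (Nat.ble 1) (fun _ => 0) (fun f => xr 4 f) T8
def e1 : List ℕ := eng 0 (fun f => and (Nat.ble 1 f) (Nat.beq (Nat.mod f 2) 0)) (fun f => f) (fun _ => 4) T1
def e4 : List ℕ := eng 1 (Nat.beq 0) (fun _ => 0) (fun _ => 4) T4
def cks (l : List ℕ) : ℕ → ℕ → ℕ :=
  List.rec (motive := fun _ => ℕ → ℕ → ℕ) (fun _ c => c) (fun a _ ih last c => frc a fun a => cnd (Nat.blt last a) (frc (Nat.succ c) fun c => ih a c) 100000) l
end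
end BR
namespace BR
theorem frc_eq {β : Type} (n : ℕ) (k : ℕ → β) : frc n k = k n := by cases n <;> rfl
theorem cnd_eq {β : Type} (b : Bool) (x y : β) : cnd b x y = if b then x else y := by cases b <;> rfl
theorem mem_sel_aux {α : Type} (f : α → ℕ) (x : ℕ) (k : List α → List ℕ) (z : ℕ) (l : List α) : ∀ acc : List α,
   z ∈ (List.rec (motive := fun _ => List α → List ℕ) (fun acc => k acc)
    (fun a _ ih acc => frc (f a) fun y => cnd (Nat.beq y x) (ih (a :: acc)) (cnd (Nat.ble x y) (ih acc) [])) l acc : List ℕ) ↔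
    (∀ g ∈ l, x ≤ f g) ∧ z ∈ k ((l.filter (fun a => f a == x)).reverse ++ acc) := by
  induction l with
  | nil => intro acc; simp
  | cons a l ih =>
    intro acc
    have key : (List.rec (motive := fun _ => List α → List ℕ) (fun acc => k acc)
      (fun a _ ih acc => frc (f a) fun y => cnd (Nat.beq y x) (ih (a :: acc)) (cnd (Nat.ble x y) (ih acc) [])) (a :: l) acc : List ℕ)
      = if f a = x then (List.rec (motive := fun _ => List α → List ℕ) (fun acc => k acc)
      (fun a _ ih acc => frc (f a) fun y => cnd (Nat.beq y x) (ih (a :: acc)) (cnd (Nat.ble x y) (ih acc) [])) l (a :: acc) : List ℕ)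
       else if x ≤ f a then (List.rec (motive := fun _ => List α → List ℕ) (fun acc => k acc)
      (fun a _ ih acc => frc (f a) fun y => cnd (Nat.beq y x) (ih (a :: acc)) (cnd (Nat.ble x y) (ih acc) [])) l acc : List ℕ) else [] := by
      refine (frc_eq _ _).trans ?_
      rw [cnd_eq, cnd_eq]
      simp only [Nat.beq_eq, Nat.ble_eq]
    rw [key]
    split_ifs with h h2
    · rw [ih]; simp [h]
    · rw [ih]; simp [h, h2]
    · simp [h2]
theorem mem_sel {α : Type} (f : α → ℕ) (x : ℕ) (k : List α → List ℕ) (z : ℕ) (l : List α) :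
   z ∈ sel f x k l ↔ (∀ g ∈ l, x ≤ f g) ∧ z ∈ k (l.filter (fun a => f a == x)).reverse := by
  have := mem_sel_aux f x k z l []
  simpa [sel] using this
theorem frcG_aux {β : Type} (k : List GP → β) (l : List GP) : ∀ acc,
  (List.rec (motive := fun _ => List GP → β) (fun acc => k acc)
    (fun a _ ih acc => GP.rec (fun tb db fb p q r s x y z w P Q R S ex => ih (⟨tb, db, fb, p,q,r,s,x,y,z,w,P,Q,R,S,ex⟩ :: acc)) a) l acc : β)
   = k (l.reverse ++ acc) := by
  induction l with
  | nil => intro acc; rfl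
  | cons a l ih => intro acc; simp only [ih]; simp
theorem frcG_eq {β : Type} (k : List GP → β) (l : List GP) : frcG l k = k l.reverse := by
  have := frcG_aux k l []
  simpa [frcG] using this
theorem eqE_iff (a b : EF) : eqE a b = true ↔ a = b := by
  cases a; cases b
  simp [eqE]; tauto
theorem mem_ins (a b : EF) (l : List EF) : b ∈ ins a l ↔ b = a ∨ b ∈ l := by
  cases l with
  | nil => simp [ins]
  | cons c t =>
    simp only [ins, cnd_eq]
    split_ifs with h
    · rw [eqE_iff] at h; subst h; simp
    · simp
theorem dde_aux (f : GP → EF) (k : List EF → List ℕ) (l : List GP) : ∀ acc : List EF, ∃ L : List EF,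
   (∀ x, x ∈ L ↔ x ∈ acc ∨ ∃ g ∈ l, f g = x) ∧
  (List.rec (motive := fun _ => List EF → List ℕ) (fun acc => k acc)
    (fun a _ ih acc => EF.rec (fun tb P Q R S c2 c3 => ih (ins ⟨tb,P,Q,R,S,c2,c3⟩ acc)) (f a)) l acc : List ℕ) = k L := by
  induction l with
  | nil => intro acc; exact ⟨acc, by simp, rfl⟩
  | cons a l ih =>
    intro acc
    obtain ⟨L, h1, h2⟩ := ih (ins (f a) acc)
    refine ⟨L, ?_, ?_⟩
    · intro x; rw [h1, mem_ins]; simp; grind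
    · rw [← h2]
theorem dde_spec (f : GP → EF) (k : List EF → List ℕ) (l : List GP) : ∃ L : List EF,
   (∀ x, x ∈ L ↔ ∃ g ∈ l, f g = x) ∧ dde f l k = k L := by
  obtain ⟨L, h1, h2⟩ := dde_aux f k l []
  exact ⟨L, by simpa using h1, h2⟩
theorem allE_iff (f : EF → ℕ) (x : ℕ) (l : List EF) : allE f x l = true ↔ ∀ a ∈ l, x ≤ f a := by
  induction l with
  | nil => simp [allE]
  | cons a l ih =>
    have : allE f x (a :: l) = cnd (Nat.ble x (f a)) (allE f x l) false := rfl
    rw [this, cnd_eq]; by_cases h : x ≤ f a <;> simp [h, ih]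
theorem mem_lpE (l : List Ent) (k : Ent → List ℕ) (z : ℕ) : z ∈ lpE l k ↔ ∃ E ∈ l, z ∈ k E := by
  induction l with
  | nil => simp [lpE]
  | cons a l ih =>
    have : lpE (a :: l) k = k a ++ lpE l k := rfl
    rw [this]; simp [ih]
theorem mem_lpA (n : ℕ) (k : ℕ → List ℕ) (z : ℕ) : z ∈ lpA n k ↔ ∃ m < n, z ∈ k m := by
  induction n with
  | zero => simp [lpA]
  | succ n ih =>
    have : lpA (n+1) k = lpA n k ++ k n := rfl
    rw [this, List.mem_append, ih]
    constructor
    · rintro (⟨m, h, h'⟩ | h)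
      · exact ⟨m, by omega, h'⟩
      · exact ⟨n, by omega, h⟩
    · rintro ⟨m, h, h'⟩
      rcases Nat.lt_succ_iff_lt_or_eq.1 h with h | rfl
      · exact Or.inl ⟨m, h, h'⟩
      · exact Or.inr h'
def ent (d b : ℕ) : Ent := 
  ⟨b, pk b d, mk 4 (bt (pk b d)) 16, Nat.land (pk b d) 15, Nat.land (Nat.shiftRight (pk b d) 4) 15, Nat.land (Nat.shiftRight (pk b d) 8) 15,
   mk 16 (bt (Nat.land (pk b d) 15)) 4, mk 16 (bt (Nat.land (Nat.shiftRight (pk b d) 4) 15)) 4, mk 16 (bt (Nat.land (Nat.shiftRight (pk b d) 8) 15)) 4⟩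
theorem mkE_eq {β : Type} (d b : ℕ) (k : Ent → β) : mkE d b k = k (ent d b) := by
  simp only [mkE, frc_eq, ent]
theorem tab_aux {β : Type} (d : ℕ) (k : List Ent → β) (n : ℕ) : ∀ acc,
  (Nat.rec (motive := fun _ => List Ent → β) (fun acc => k acc) (fun m ih acc => mkE d m fun E => ih (E :: acc)) n acc : β)
   = k ((List.range n).map (ent d) ++ acc) := by
  induction n with
  | zero => intro acc; rfl
  | succ n ih => intro acc; refine (mkE_eq _ _ _).trans ?_; rw [ih]; simp [List.range_succ]
theorem tab_eq {β : Type} (d : ℕ) (k : List Ent → β) : tab d k = k ((List.range 64).map (ent d)) := by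
  have := tab_aux d k 64 []
  simpa [tab] using this

theorem mem_eng (e : ℕ) (okf : ℕ → Bool) (d0 d2 : ℕ → ℕ) (T : List GP) (z : ℕ) :
   z ∈ eng e okf d0 d2 T ↔ ∃ f < 16, okf f = true ∧ (∀ g ∈ T, f ≤ lk4 g.fb f) ∧ ∃ b1 < 64, ∃ b0 < 64,
    (asc e 0 (ent (d0 f) b0) (ent 0 b1) (ent (d0 f) b0) (ent (d0 f) b0) = true ∧
     asc e 0 (ent (d0 f) b0) (ent 0 b1) (ent 0 b1) (ent 0 b1) = true) ∧
    (∀ g ∈ T, lk4 g.fb f = f → 64 * b1 + b0 ≤ aB b0 b1 (d0 f) 0 g) ∧ 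
    ∃ b3 < 64, asc e 0 (ent (d0 f) b0) (ent 0 b1) (ent 8 b3) (ent 8 b3) = true ∧
    ∃ b2 < 64, asc e 1 (ent (d0 f) b0) (ent 0 b1) (ent (d2 f) b2) (ent 8 b3) = true ∧
    (∀ g ∈ T, lk4 g.fb f = f → aB b0 b1 (d0 f) 0 g = 64 * b1 + b0 → 64 * b3 + b2 ≤ aE b2 b3 (toE b0 b1 (d0 f) 0 (d2 f) 8 g)) ∧
    z = key f (64 * b1 + b0) (64 * b3 + b2) := by
  unfold eng
  rw [frcG_eq, mem_lpA]
  refine exists_congr fun f => and_congr_right fun hf => ?_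
  rw [cnd_eq]
  by_cases hok : okf f = true
  swap
  · simp [hok]
  simp only [hok, if_true, true_and, mem_sel, frc_eq, List.mem_reverse]
  refine and_congr_right fun hT => ?_
  simp only [levB, tab_eq, mem_lpE, List.mem_map, List.mem_range, exists_exists_and_eq_and]
  refine exists_congr fun b1 => and_congr_right fun hb1 => ?_
  refine exists_congr fun b0 => and_congr_right fun hb0 => ?_
  rw [cnd_eq, ← Bool.and_eq_true]
  by_cases ha : (asc e 0 (ent (d0 f) b0) (ent 0 b1) (ent (d0 f) b0) (ent (d0 f) b0) && asc e 0 (ent (d0 f) b0) (ent 0 b1) (ent 0 b1) (ent 0 b1)) = true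
  swap
  · simp only [ha]; simp
  have hb : ∀ d b, (ent d b).b = b := fun d b => rfl
  simp only [ha, if_true, true_and, frc_eq, mem_sel, hb]
  have hs : Nat.add (Nat.mul 64 b1) b0 = 64 * b1 + b0 := rfl
  have hs' : ∀ b3 b2, Nat.add (Nat.mul 64 b3) b2 = 64 * b3 + b2 := fun _ _ => rfl
  rw [hs]
  refine and_congr (by simp) ?_
  obtain ⟨L, hL, hL'⟩ := dde_spec (toE b0 b1 (d0 f) 0 (d2 f) 8) (levG e f (64*b1+b0) (ent (d0 f) b0) (ent 0 b1)
     ((List.range 64).map (ent (d2 f))) ((List.range 64).map (ent 8)))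
     (List.filter (fun a => aB b0 b1 (d0 f) 0 a == 64 * b1 + b0) (List.filter (fun a => lk4 a.fb f == f) T.reverse).reverse).reverse
  rw [hL']
  simp only [levG, mem_lpE, List.mem_map, List.mem_range, exists_exists_and_eq_and]
  refine exists_congr fun b3 => and_congr_right fun hb3 => ?_
  rw [cnd_eq]
  by_cases h3 : asc e 0 (ent (d0 f) b0) (ent 0 b1) (ent 8 b3) (ent 8 b3) = true
  swap
  · simp only [h3]; simp
  simp only [h3, if_true, true_and, mem_lpE, List.mem_map, List.mem_range, exists_exists_and_eq_and]
  refine exists_congr fun b2 => and_congr_right fun hb2 => ?_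
  rw [cnd_eq]
  by_cases h2 : asc e 1 (ent (d0 f) b0) (ent 0 b1) (ent (d2 f) b2) (ent 8 b3) = true
  swap
  · simp only [h2]; simp
  simp only [h2, if_true, true_and, frc_eq, hb, hs', cnd_eq]
  have hall : allE (aE b2 b3) (64 * b3 + b2) L = true ↔ ∀ g ∈ T,
        lk4 g.fb f = f → aB b0 b1 (d0 f) 0 g = 64 * b1 + b0 → 64 * b3 + b2 ≤ aE b2 b3 (toE b0 b1 (d0 f) 0 (d2 f) 8 g) := by
    rw [allE_iff]
    constructor
    · intro h g hg h1 h2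
      refine h _ ((hL _).2 ⟨g, ?_, rfl⟩)
      simp [hg, h1, h2]
    · intro h x hx
      obtain ⟨g, hg, rfl⟩ := (hL _).1 hx
      simp at hg
      exact h g hg.1 hg.2.2 hg.2.1
  rw [← hall]
  split_ifs with h <;> simp [h]
end BR
namespace BR
def bz (n k : ℕ) : ZMod 2 := ((bt n k : ℕ) : ZMod 2)
theorem bt_eq (n k : ℕ) : bt n k = (n.testBit k).toNat := by
  have : bt n k = (n >>> k) &&& 1 := rfl
  rw [this, Nat.testBit, Nat.and_one_is_mod, Nat.one_and_eq_mod_two]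
  rcases Nat.mod_two_eq_zero_or_one (n >>> k) with h | h <;> simp [h]
theorem bt_le (n k : ℕ) : bt n k ≤ 1 := by rw [bt_eq]; exact Bool.toNat_le _
theorem bz_eq (n k : ℕ) : bz n k = if n.testBit k then 1 else 0 := by
  rw [bz, bt_eq]; cases n.testBit k <;> simp
theorem bz_eq_iff (a b k l : ℕ) : bz a k = bz b l ↔ a.testBit k = b.testBit l := by
  rw [bz_eq, bz_eq]; cases a.testBit k <;> cases b.testBit l <;> simp
theorem bz_xr (a b k : ℕ) : bz (xr a b) k = bz a k + bz b k := by
  have : xr a b = a ^^^ b := rfl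
  rw [bz_eq, bz_eq, bz_eq, this, Nat.testBit_xor]
  cases a.testBit k <;> cases b.testBit k <;> simp <;> decide
theorem bz_zero (k : ℕ) : bz 0 k = 0 := by simp [bz_eq]
theorem bz_mul {P : ℕ} (hP : P ≤ 1) (x k : ℕ) : bz (Nat.mul P x) k = (P : ZMod 2) * bz x k := by
  have : Nat.mul P x = P * x := rfl
  rw [this]
  interval_cases P <;> simp [bz_zero]
theorem bz_inj (n : ℕ) {a b : ℕ} (ha : a < 2 ^ n) (hb : b < 2 ^ n) (h : ∀ k < n, bz a k = bz b k) : a = b := by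
  apply Nat.eq_of_testBit_eq
  intro i
  by_cases hi : i < n
  · exact (bz_eq_iff _ _ _ _).1 (h i hi)
  · rw [Nat.testBit_lt_two_pow, Nat.testBit_lt_two_pow]
    · exact lt_of_lt_of_le hb (Nat.pow_le_pow_right (by norm_num) (by omega))
    · exact lt_of_lt_of_le ha (Nat.pow_le_pow_right (by norm_num) (by omega))
theorem mk_succ (w : ℕ) (f : ℕ → ℕ) (n : ℕ) : mk w f (n+1) = 2 ^ (w*n) * f n + mk w f n := by
  have : mk w f (n+1) = mk w f n + (f n) <<< (w * n) := rfl
  rw [this, Nat.shiftLeft_eq]; ring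
theorem mk_lt (w : ℕ) (f : ℕ → ℕ) (hf : ∀ m, f m < 2 ^ w) (n : ℕ) : mk w f n < 2 ^ (w * n) := by
  induction n with
  | zero => simp [mk]
  | succ n ih =>
    rw [mk_succ, Nat.mul_succ, Nat.pow_add]
    have := hf n
    nlinarith [Nat.mul_le_mul_left (2 ^ (w*n)) (Nat.succ_le_of_lt (hf n))]
theorem mk_testBit (w : ℕ) (f : ℕ → ℕ) (hf : ∀ m, f m < 2 ^ w) (n : ℕ) : ∀ m < n, ∀ k < w,
    (mk w f n).testBit (w * m + k) = (f m).testBit k := by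
  induction n with
  | zero => intro m h; omega
  | succ n ih =>
    intro m hm k hk
    rw [mk_succ, Nat.testBit_two_pow_mul_add _ (mk_lt w f hf n)]
    rcases Nat.lt_succ_iff_lt_or_eq.1 hm with h | rfl
    · have : w * m + k < w * n := by nlinarith
      rw [if_pos this, ih m h k hk]
    · rw [if_neg (by omega)]; congr 1; omega
theorem mk_mul (w : ℕ) (f : ℕ → ℕ) (c : ℕ) (n : ℕ) : mk w f n * c = mk w (fun m => f m * c) n := by
  induction n with
  | zero => simp [mk]
  | succ n ih => rw [mk_succ, mk_succ, ← ih]; ring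
theorem lk6_mk (f : ℕ → ℕ) (hf : ∀ m, f m < 64) {n b : ℕ} (hb : b < n) : lk6 (mk 6 f n) b = f b := by
  have : lk6 (mk 6 f n) b = (mk 6 f n >>> (6 * b)) &&& 63 := rfl
  rw [this]
  apply Nat.eq_of_testBit_eq
  intro i
  have h63 : (63 : ℕ) = 2 ^ 6 - 1 := by norm_num
  rw [Nat.testBit_and, Nat.testBit_shiftRight, h63, Nat.testBit_two_pow_sub_one]
  by_cases hi : i < 6
  · rw [mk_testBit 6 f hf n b hb i hi]; simp [hi]
  · rw [Nat.testBit_lt_two_pow (lt_of_lt_of_le (hf b) (show 64 ≤ 2 ^ i from le_trans (by norm_num : 64 ≤ 2 ^ 6) (Nat.pow_le_pow_right (by norm_num) (by omega))))]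
    simp [hi]
theorem lk4_mk (f : ℕ → ℕ) (hf : ∀ m, f m < 16) {n b : ℕ} (hb : b < n) : lk4 (mk 4 f n) b = f b := by
  have : lk4 (mk 4 f n) b = (mk 4 f n >>> (4 * b)) &&& 15 := rfl
  rw [this]
  apply Nat.eq_of_testBit_eq
  intro i
  have h63 : (15 : ℕ) = 2 ^ 4 - 1 := by norm_num
  rw [Nat.testBit_and, Nat.testBit_shiftRight, h63, Nat.testBit_two_pow_sub_one]
  by_cases hi : i < 4
  · rw [mk_testBit 4 f hf n b hb i hi]; simp [hi]
  · rw [Nat.testBit_lt_two_pow (lt_of_lt_of_le (hf b) (show 16 ≤ 2 ^ i from le_trans (by norm_num : 16 ≤ 2 ^ 4) (Nat.pow_le_pow_right (by norm_num) (by omega))))]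
    simp [hi]
theorem lk6_lt (t b : ℕ) : lk6 t b < 64 := by
  have : lk6 t b = (t >>> (6 * b)) &&& 63 := rfl
  rw [this]; exact Nat.and_lt_two_pow (n := 6) _ (by norm_num)
theorem lk4_lt (t b : ℕ) : lk4 t b < 16 := by
  have : lk4 t b = (t >>> (4 * b)) &&& 15 := rfl
  rw [this]; exact Nat.and_lt_two_pow (n := 4) _ (by norm_num)
theorem xr_lt {a b : ℕ} (n : ℕ) (ha : a < 2^n) (hb : b < 2^n) : xr a b < 2^n := Nat.xor_lt_two_pow ha hb
theorem ml_lt {P x : ℕ} (n : ℕ) (hP : P ≤ 1) (hx : x < 2^n) : Nat.mul P x < 2^n := by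
  have : Nat.mul P x = P * x := rfl
  rw [this]; interval_cases P <;> simp [hx]
theorem enc6_lt {a b c d e f : ℕ} (ha : a ≤ 1) (hb : b ≤ 1) (hc : c ≤ 1) (hd : d ≤ 1) (he : e ≤ 1) (hf : f ≤ 1) : enc6 a b c d e f < 64 := by
  have : enc6 a b c d e f = a + 2 * (b + 2 * (c + 2 * (d + 2 * (e + 2 * f)))) := rfl
  omega
theorem enc4_lt {a b c d : ℕ} (ha : a ≤ 1) (hb : b ≤ 1) (hc : c ≤ 1) (hd : d ≤ 1) : enc4 a b c d < 16 := by
  have : enc4 a b c d = a + 2 * (b + 2 * (c + 2 * d)) := rfl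
  omega
theorem bz_enc6 {a b c d e f : ℕ} (ha : a ≤ 1) (hb : b ≤ 1) (hc : c ≤ 1) (hd : d ≤ 1) (he : e ≤ 1) (hf : f ≤ 1) :
   bz (enc6 a b c d e f) 0 = a ∧ bz (enc6 a b c d e f) 1 = b ∧ bz (enc6 a b c d e f) 2 = c ∧
   bz (enc6 a b c d e f) 3 = d ∧ bz (enc6 a b c d e f) 4 = e ∧ bz (enc6 a b c d e f) 5 = f := by
  interval_cases a <;> interval_cases b <;> interval_cases c <;> interval_cases d <;> interval_cases e <;> interval_cases f <;> decide
theorem bz_enc4 {a b c d : ℕ} (ha : a ≤ 1) (hb : b ≤ 1) (hc : c ≤ 1) (hd : d ≤ 1) :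
   bz (enc4 a b c d) 0 = a ∧ bz (enc4 a b c d) 1 = b ∧ bz (enc4 a b c d) 2 = c ∧
   bz (enc4 a b c d) 3 = d := by
  interval_cases a <;> interval_cases b <;> interval_cases c <;> interval_cases d <;> decide
theorem mn_le (a b c d : ℕ) : mn a b c d ≤ 1 := by
  have : mn a b c d = (a * d + b * c) % 2 := rfl
  omega
theorem mn_cast (a b c d : ℕ) : ((mn a b c d : ℕ) : ZMod 2) = a * d + b * c := by
  have : mn a b c d = (a * d + b * c) % 2 := rfl
  rw [this, ZMod.natCast_mod]; push_cast; rfl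

def pidx (i j : Fin 4) : ℕ := ![![0,0,1,2],![0,0,3,4],![1,3,0,5],![2,4,5,0]] i j
def pi : Fin 6 → Fin 4 := ![0,0,0,1,1,2]
def pj : Fin 6 → Fin 4 := ![1,2,3,2,3,3]
def Sm (b d : ℕ) (i j : Fin 4) : ZMod 2 := if i = j then bz d i else bz b (pidx i j)
theorem Sm_symm (b d : ℕ) (i j : Fin 4) : Sm b d i j = Sm b d j i := by
  have : pidx i j = pidx j i := by revert i j; decide
  unfold Sm; rw [this]; by_cases h : i = j
  · subst h; rfl
  · rw [if_neg h, if_neg (Ne.symm h)]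
def al (a b c d : ℕ) (i k : Fin 4) : ZMod 2 := bz (![a,b,c,d] i) k

theorem bz_lin6 (c0 c1 c2 c3 c4 c5 b n : ℕ) : bz (lin6 c0 c1 c2 c3 c4 c5 b) n =
   bz b 0 * bz c0 n + (bz b 1 * bz c1 n + (bz b 2 * bz c2 n + (bz b 3 * bz c3 n + (bz b 4 * bz c4 n + bz b 5 * bz c5 n)))) := by
  have : lin6 c0 c1 c2 c3 c4 c5 b = xr (Nat.mul (bt b 0) c0) (xr (Nat.mul (bt b 1) c1) (xr (Nat.mul (bt b 2) c2) (xr (Nat.mul (bt b 3) c3) (xr (Nat.mul (bt b 4) c4) (Nat.mul (bt b 5) c5))))) := rfl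
  rw [this]; simp only [bz_xr, bz_mul (bt_le _ _)]; rfl
theorem bz_lin4 (c0 c1 c2 c3 b n : ℕ) : bz (lin4 c0 c1 c2 c3 b) n =
   bz b 0 * bz c0 n + (bz b 1 * bz c1 n + (bz b 2 * bz c2 n + (bz b 3 * bz c3 n))) := by
  have : lin4 c0 c1 c2 c3 b = xr (Nat.mul (bt b 0) c0) (xr (Nat.mul (bt b 1) c1) (xr (Nat.mul (bt b 2) c2) (Nat.mul (bt b 3) c3))) := rfl
  rw [this]; simp only [bz_xr, bz_mul (bt_le _ _)]; rfl
theorem lin6_lt (c0 c1 c2 c3 c4 c5 b n : ℕ) (h0 : c0 < 2^n) (h1 : c1 < 2^n) (h2 : c2 < 2^n) (h3 : c3 < 2^n) (h4 : c4 < 2^n) (h5 : c5 < 2^n) :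
   lin6 c0 c1 c2 c3 c4 c5 b < 2^n := by
  have : lin6 c0 c1 c2 c3 c4 c5 b = xr (Nat.mul (bt b 0) c0) (xr (Nat.mul (bt b 1) c1) (xr (Nat.mul (bt b 2) c2) (xr (Nat.mul (bt b 3) c3) (xr (Nat.mul (bt b 4) c4) (Nat.mul (bt b 5) c5))))) := rfl
  rw [this]
  repeat' first | apply xr_lt | apply ml_lt _ (bt_le _ _)
  all_goals assumption
theorem lin4_lt (c0 c1 c2 c3 b n : ℕ) (h0 : c0 < 2^n) (h1 : c1 < 2^n) (h2 : c2 < 2^n) (h3 : c3 < 2^n) :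
   lin4 c0 c1 c2 c3 b < 2^n := by
  have : lin4 c0 c1 c2 c3 b = xr (Nat.mul (bt b 0) c0) (xr (Nat.mul (bt b 1) c1) (xr (Nat.mul (bt b 2) c2) (Nat.mul (bt b 3) c3))) := rfl
  rw [this]
  repeat' first | apply xr_lt | apply ml_lt _ (bt_le _ _)
  all_goals assumption
theorem col_lt (a b c d k l : ℕ) : col a b c d k l < 2 ^ 6 := enc6_lt (mn_le _ _ _ _) (mn_le _ _ _ _) (mn_le _ _ _ _) (mn_le _ _ _ _) (mn_le _ _ _ _) (mn_le _ _ _ _)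
theorem bb_le (a b k l : ℕ) : Nat.mul (bt a k) (bt b l) ≤ 1 := by
  have h1 := bt_le a k
  have h2 := bt_le b l
  have : Nat.mul (bt a k) (bt b l) = bt a k * bt b l := rfl
  rw [this]; nlinarith
theorem bb_cast (a b k l : ℕ) : ((Nat.mul (bt a k) (bt b l) : ℕ) : ZMod 2) = bz a k * bz b l := by
  have : Nat.mul (bt a k) (bt b l) = bt a k * bt b l := rfl
  rw [this]; push_cast; rfl
theorem dcol_lt (a b c d k : ℕ) : dcol a b c d k < 2 ^ 6 := enc6_lt (bb_le _ _ _ _) (bb_le _ _ _ _) (bb_le _ _ _ _) (bb_le _ _ _ _) (bb_le _ _ _ _) (bb_le _ _ _ _)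
theorem fcol_lt (a b c d k : ℕ) : fcol a b c d k < 2 ^ 4 := enc4_lt (bt_le _ _) (bt_le _ _) (bt_le _ _) (bt_le _ _)
theorem lk6_TB (a b c d : ℕ) {x : ℕ} (hx : x < 64) : lk6 (mkTB a b c d) x = 
   lin6 (col a b c d 0 1) (col a b c d 0 2) (col a b c d 0 3) (col a b c d 1 2) (col a b c d 1 3) (col a b c d 2 3) x := by
  simp only [mkTB, frc_eq]
  exact lk6_mk _ (fun m => lin6_lt _ _ _ _ _ _ _ 6 (col_lt _ _ _ _ _ _) (col_lt _ _ _ _ _ _) (col_lt _ _ _ _ _ _) (col_lt _ _ _ _ _ _) (col_lt _ _ _ _ _ _) (col_lt _ _ _ _ _ _)) hx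
theorem lk6_DB (a b c d : ℕ) {x : ℕ} (hx : x < 16) : lk6 (mkDB a b c d) x = 
   lin4 (dcol a b c d 0) (dcol a b c d 1) (dcol a b c d 2) (dcol a b c d 3) x := by
  simp only [mkDB, frc_eq]
  exact lk6_mk _ (fun m => lin4_lt _ _ _ _ _ 6 (dcol_lt _ _ _ _ _) (dcol_lt _ _ _ _ _) (dcol_lt _ _ _ _ _) (dcol_lt _ _ _ _ _)) hx
theorem lk4_FB (a b c d : ℕ) {x : ℕ} (hx : x < 16) : lk4 (mkFB a b c d) x = 
   lin4 (fcol a b c d 0) (fcol a b c d 1) (fcol a b c d 2) (fcol a b c d 3) x := by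
  simp only [mkFB, frc_eq]
  exact lk4_mk _ (fun m => lin4_lt _ _ _ _ _ 4 (fcol_lt _ _ _ _ _) (fcol_lt _ _ _ _ _) (fcol_lt _ _ _ _ _) (fcol_lt _ _ _ _ _)) hx
theorem bz_col (a b c d : ℕ) (k l : Fin 4) (n : Fin 6) : bz (col a b c d k l) n =
   al a b c d (pi n) k * al a b c d (pj n) l + al a b c d (pi n) l * al a b c d (pj n) k := by
  have := bz_enc6 (mn_le (bt a k) (bt a l) (bt b k) (bt b l)) (mn_le (bt a k) (bt a l) (bt c k) (bt c l)) (mn_le (bt a k) (bt a l) (bt d k) (bt d l))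
     (mn_le (bt b k) (bt b l) (bt c k) (bt c l)) (mn_le (bt b k) (bt b l) (bt d k) (bt d l)) (mn_le (bt c k) (bt c l) (bt d k) (bt d l))
  simp only [mn_cast] at this
  obtain ⟨h0, h1, h2, h3, h4, h5⟩ := this
  fin_cases n
  exacts [h0, h1, h2, h3, h4, h5]
theorem bz_dcol (a b c d : ℕ) (k : Fin 4) (n : Fin 6) : bz (dcol a b c d k) n =
   al a b c d (pi n) k * al a b c d (pj n) k := by
  have := bz_enc6 (bb_le a b k k) (bb_le a c k k) (bb_le a d k k) (bb_le b c k k) (bb_le b d k k) (bb_le c d k k)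
  simp only [bb_cast] at this
  obtain ⟨h0, h1, h2, h3, h4, h5⟩ := this
  fin_cases n
  exacts [h0, h1, h2, h3, h4, h5]
theorem bz_fcol (a b c d : ℕ) (k : Fin 4) (n : Fin 4) : bz (fcol a b c d k) n = al a b c d n k := by
  have := bz_enc4 (bt_le a k) (bt_le b k) (bt_le c k) (bt_le d k)
  obtain ⟨h0, h1, h2, h3⟩ := this
  fin_cases n
  exacts [h0, h1, h2, h3]
theorem bz_aX (a b c d : ℕ) {x y : ℕ} (hx : x < 64) (hy : y < 16) (n : Fin 6) :
   bz (aX (mkTB a b c d) (mkDB a b c d) x y) n = ∑ k, ∑ l, Sm x y k l * al a b c d (pi n) k * al a b c d (pj n) l := by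
  rw [aX, bz_xr, lk6_TB _ _ _ _ hx, lk6_DB _ _ _ _ hy, bz_lin6, bz_lin4]
  have h := fun k l => bz_col a b c d k l n
  have h' := fun k => bz_dcol a b c d k n
  have h01 := h 0 1; have h02 := h 0 2; have h03 := h 0 3; have h12 := h 1 2; have h13 := h 1 3; have h23 := h 2 3
  have h0 := h' 0; have h1 := h' 1; have h2 := h' 2; have h3 := h' 3
  simp only [Fin.val_zero, Fin.val_one, Fin.val_two, show ((3 : Fin 4) : ℕ) = 3 from rfl] at h01 h02 h03 h12 h13 h23 h0 h1 h2 h3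
  rw [h01, h02, h03, h12, h13, h23, h0, h1, h2, h3]
  simp only [Fin.sum_univ_four, Sm]
  simp only [Fin.isValue, reduceIte, Fin.reduceEq]
  simp only [pidx, Matrix.cons_val, Fin.val_zero, Fin.val_one, Fin.val_two, show ((3 : Fin 4) : ℕ) = 3 from rfl, Fin.isValue]
  ring
theorem bz_fb (a b c d : ℕ) {x : ℕ} (hx : x < 16) (n : Fin 4) :
   bz (lk4 (mkFB a b c d) x) n = ∑ k : Fin 4, bz x k * al a b c d n k := by
  rw [lk4_FB _ _ _ _ hx, bz_lin4]
  have h' := fun k => bz_fcol a b c d k n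
  have h0 := h' 0; have h1 := h' 1; have h2 := h' 2; have h3 := h' 3
  simp only [Fin.val_zero, Fin.val_one, Fin.val_two, show ((3 : Fin 4) : ℕ) = 3 from rfl] at h0 h1 h2 h3
  rw [h0, h1, h2, h3]
  simp only [Fin.sum_univ_four]
  simp only [Fin.val_zero, Fin.val_one, Fin.val_two, show ((3 : Fin 4) : ℕ) = 3 from rfl, Fin.isValue]
  ring
end BR
namespace BR
theorem bz_pow (n k : ℕ) : bz (2 ^ n) k = if k = n then 1 else 0 := by
  rw [bz_eq, Nat.testBit_two_pow]; by_cases h : n = k <;> simp [h, eq_comm]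
theorem bz_ge {n x k : ℕ} (hx : x < 2 ^ n) (hk : n ≤ k) : bz x k = 0 := by
  rw [bz_eq, Nat.testBit_lt_two_pow (lt_of_lt_of_le hx (Nat.pow_le_pow_right (by norm_num) hk))]; simp
theorem bz_pow_mul (n x k : ℕ) : bz (2 ^ n * x) k = if n ≤ k then bz x (k - n) else 0 := by
  rw [bz_eq, Nat.testBit_two_pow_mul]; by_cases h : n ≤ k <;> simp [h, bz_eq]
theorem bz_mk (w : ℕ) (f : ℕ → ℕ) (hf : ∀ m, f m < 2 ^ w) (n m k : ℕ) (hm : m < n) (hk : k < w) :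
    bz (mk w f n) (w * m + k) = bz (f m) k := by
  rw [bz_eq_iff]; exact mk_testBit w f hf n m hm k hk
theorem btmul_lt {w a m c : ℕ} (hc : c < 2 ^ w) : bt a m * c < 2 ^ w := ml_lt w (bt_le a m) hc
theorem bz_spread (w a c n m k : ℕ) (hc : c < 2 ^ w) (hm : m < n) (hk : k < w) :
    bz (Nat.mul (mk w (bt a) n) c) (w * m + k) = bz a m * bz c k := by
  have : Nat.mul (mk w (bt a) n) c = mk w (bt a) n * c := rfl
  rw [this, mk_mul, bz_mk w _ (fun m => btmul_lt hc) n m k hm hk]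
  exact bz_mul (bt_le _ _) _ _
theorem spread_lt (w a c n N : ℕ) (hN : N = w * n) (hc : c < 2 ^ w) : Nat.mul (mk w (bt a) n) c < 2 ^ N := by
  subst hN
  have : Nat.mul (mk w (bt a) n) c = mk w (bt a) n * c := rfl
  rw [this, mk_mul]; exact mk_lt w _ (fun m => btmul_lt hc) n
theorem pk_eq (b d : ℕ) : pk b d = 2 ^ 4 * (2 ^ 4 * (2 ^ 4 * enc4 (bt b 2) (bt b 4) (bt b 5) (bt d 3) + enc4 (bt b 1) (bt b 3) (bt d 2) (bt b 5)) +
   enc4 (bt b 0) (bt d 1) (bt b 3) (bt b 4)) + enc4 (bt d 0) (bt b 0) (bt b 1) (bt b 2) := by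
  simp only [pk, enc4, Nat.add_eq, Nat.mul_eq]; ring
theorem bz_low (n a b k : ℕ) (hb : b < 2 ^ n) : bz (2 ^ n * a + b) k = if k < n then bz b k else bz a (k - n) := by
  rw [bz_eq, Nat.testBit_two_pow_mul_add _ hb]; by_cases h : k < n <;> simp [h, bz_eq]
theorem pk_lt (b d : ℕ) : pk b d < 2 ^ 16 := by
  rw [pk_eq]
  have h0 := enc4_lt (bt_le b 2) (bt_le b 4) (bt_le b 5) (bt_le d 3)
  have h1 := enc4_lt (bt_le b 1) (bt_le b 3) (bt_le d 2) (bt_le b 5)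
  have h2 := enc4_lt (bt_le b 0) (bt_le d 1) (bt_le b 3) (bt_le b 4)
  have h3 := enc4_lt (bt_le d 0) (bt_le b 0) (bt_le b 1) (bt_le b 2)
  omega
theorem bz_pk (b d : ℕ) (i j : Fin 4) : bz (pk b d) (4 * i + j) = Sm b d i j := by
  have l0 := enc4_lt (bt_le b 2) (bt_le b 4) (bt_le b 5) (bt_le d 3)
  have l1 := enc4_lt (bt_le b 1) (bt_le b 3) (bt_le d 2) (bt_le b 5)
  have l2 := enc4_lt (bt_le b 0) (bt_le d 1) (bt_le b 3) (bt_le b 4)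
  have l3 := enc4_lt (bt_le d 0) (bt_le b 0) (bt_le b 1) (bt_le b 2)
  obtain ⟨a0, a1, a2, a3⟩ := bz_enc4 (bt_le b 2) (bt_le b 4) (bt_le b 5) (bt_le d 3)
  obtain ⟨b0, b1, b2, b3⟩ := bz_enc4 (bt_le b 1) (bt_le b 3) (bt_le d 2) (bt_le b 5)
  obtain ⟨c0, c1, c2, c3⟩ := bz_enc4 (bt_le b 0) (bt_le d 1) (bt_le b 3) (bt_le b 4)
  obtain ⟨d0, d1, d2, d3⟩ := bz_enc4 (bt_le d 0) (bt_le b 0) (bt_le b 1) (bt_le b 2)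
  rw [pk_eq]
  rw [bz_low 4 _ _ _ l3, bz_low 4 _ _ _ l2, bz_low 4 _ _ _ l1]
  fin_cases i <;> fin_cases j
  exacts [d0,d1,d2,d3,c0,c1,c2,c3,b0,b1,b2,b3,a0,a1,a2,a3]
theorem bz_land15 (a k : ℕ) (hk : k < 4) : bz (Nat.land a 15) k = bz a k := by
  have : Nat.land a 15 = a &&& (2 ^ 4 - 1) := rfl
  rw [this, bz_eq_iff, Nat.testBit_and, Nat.testBit_two_pow_sub_one]; simp [hk]
theorem bz_shr (a m k : ℕ) : bz (Nat.shiftRight a m) k = bz a (m + k) := by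
  have : Nat.shiftRight a m = a >>> m := rfl
  rw [this, bz_eq_iff, Nat.testBit_shiftRight]
theorem land15_lt (a : ℕ) : Nat.land a 15 < 2 ^ 4 := Nat.and_lt_two_pow (n := 4) _ (by norm_num)
def Lh (e e2 : ℕ) (S0 S1 Sr S3 : Fin 4 → Fin 4 → ZMod 2) (i j k : Fin 4) : ZMod 2 :=
  S0 i j * Sr 0 k + S1 i j * Sr 1 k + e * ((if i = 3 ∧ j = 3 then Sr 2 k else 0) + e2 * (if k = 3 then S3 i j else 0))
theorem bz8 : ∀ k : Fin 4, bz 8 k = if k = 3 then 1 else 0 := by decide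
theorem bz32768 (j k : Fin 4) : bz 32768 (4 * j + k) = if k = 3 ∧ j = 3 then 1 else 0 := by
  rw [show 32768 = 2 ^ 15 by norm_num, bz_pow]
  have : (4 * (j:ℕ) + k = 15) ↔ (k = 3 ∧ j = 3) := by
    rw [Fin.ext_iff, Fin.ext_iff]; simp; omega
  simp only [this]
theorem asc_gen {e e2 : ℕ} (he : e ≤ 1) (he2 : e2 ≤ 1) (E0 E1 Er E3 : Ent) (d0 b0 d1 b1 dr br d3 b3 : ℕ)
   (hr0 : ∀ k : Fin 4, bz Er.r0 k = Sm br dr 0 k) (hr1 : ∀ k : Fin 4, bz Er.r1 k = Sm br dr 1 k) (hr2 : ∀ k : Fin 4, bz Er.r2 k = Sm br dr 2 k)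
   (hs0 : E0.s = mk 4 (bt (pk b0 d0)) 16) (hs1 : E1.s = mk 4 (bt (pk b1 d1)) 16) (hs3 : E3.s = mk 4 (bt (pk b3 d3)) 16)
   (ht0 : Er.t0 = mk 16 (bt Er.r0) 4) (ht1 : Er.t1 = mk 16 (bt Er.r1) 4) (ht2 : Er.t2 = mk 16 (bt Er.r2) 4)
   (hpa0 : E0.a = pk b0 d0) (hpa1 : E1.a = pk b1 d1) (hpa3 : E3.a = pk b3 d3)
   (hl0 : Er.r0 < 2 ^ 4) (hl1 : Er.r1 < 2 ^ 4) (hl2 : Er.r2 < 2 ^ 4) :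
   asc e e2 E0 E1 Er E3 = true ↔
   ∀ i j k, Lh e e2 (Sm b0 d0) (Sm b1 d1) (Sm br dr) (Sm b3 d3) i j k = Lh e e2 (Sm b0 d0) (Sm b1 d1) (Sm br dr) (Sm b3 d3) k j i := by
  obtain ⟨X, hX⟩ : ∃ X, X = (xr (xr (Nat.mul E0.s Er.r0) (Nat.mul E1.s Er.r1)) (Nat.mul e (xr (Nat.mul 1152921504606846976 Er.r2) (Nat.mul e2 (Nat.mul 8 E3.s))))) := ⟨_, rfl⟩
  obtain ⟨Y, hY⟩ : ∃ Y, Y = (xr (xr (Nat.mul Er.t0 E0.a) (Nat.mul Er.t1 E1.a)) (Nat.mul e (xr (Nat.mul 32768 Er.t2) (Nat.mul e2 (Nat.mul 281474976710656 E3.a))))) := ⟨_, rfl⟩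
  have hXY : asc e e2 E0 E1 Er E3 = true ↔ X = Y := by
    rw [hX, hY, asc, Nat.beq_eq]
  have h8 : Nat.mul 8 E3.s = Nat.mul (mk 4 (bt (pk b3 d3)) 16) 8 := by
    rw [hs3, Nat.mul_eq, Nat.mul_eq, mul_comm]
  have h32 : Nat.mul 32768 Er.t2 = Nat.mul (mk 16 (bt Er.r2) 4) 32768 := by
    rw [ht2, Nat.mul_eq, Nat.mul_eq, mul_comm]
  have h60 : Nat.mul 1152921504606846976 Er.r2 = 2 ^ 60 * Er.r2 := by
    rw [Nat.mul_eq]; norm_num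
  have h48 : Nat.mul 281474976710656 E3.a = 2 ^ 48 * E3.a := by
    rw [Nat.mul_eq]; norm_num
  have ha3 : E3.a < 2 ^ 16 := by
    simp only [hpa0, hpa1, hpa3]; exact pk_lt _ _
  have ha0 : E0.a < 2 ^ 16 := by
    simp only [hpa0, hpa1, hpa3]; exact pk_lt _ _
  have ha1 : E1.a < 2 ^ 16 := by
    simp only [hpa0, hpa1, hpa3]; exact pk_lt _ _
  rw [hs0, hs1] at hX
  rw [ht0, ht1] at hY
  have hXl : X < 2 ^ 64 := by
    rw [hX]
    refine xr_lt _ (xr_lt _ (spread_lt 4 _ _ 16 64 rfl hl0) (spread_lt 4 _ _ 16 64 rfl hl1)) (ml_lt _ he (xr_lt _ ?_ (ml_lt _ he2 ?_)))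
    · rw [h60]; omega
    · rw [h8]; exact spread_lt 4 _ _ 16 64 rfl (by norm_num)
  have hYl : Y < 2 ^ 64 := by
    rw [hY]
    refine xr_lt _ (xr_lt _ (spread_lt 16 _ _ 4 64 rfl ha0) (spread_lt 16 _ _ 4 64 rfl ha1)) (ml_lt _ he (xr_lt _ ?_ (ml_lt _ he2 ?_)))
    · rw [h32]; exact spread_lt 16 _ _ 4 64 rfl (by norm_num)
    · rw [h48]; omega
  have bX : ∀ i j k : Fin 4, bz X (16 * i + 4 * j + k) = Lh e e2 (Sm b0 d0) (Sm b1 d1) (Sm br dr) (Sm b3 d3) i j k := by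
    intro i j k
    have hn : (16 * (i : ℕ) + 4 * j + k) = 4 * (4 * i + j) + k := by ring
    have hij : 4 * (i:ℕ) + j < 16 := by omega
    rw [hX, bz_xr, bz_xr, bz_mul he, bz_xr, bz_mul he2, h8, h60, hn]
    rw [bz_spread 4 _ _ 16 _ _ hl0 hij k.2, bz_spread 4 _ _ 16 _ _ hl1 hij k.2, bz_spread 4 _ _ 16 _ _ (by norm_num) hij k.2, bz_pk, bz_pk, bz_pk, hr0, hr1, bz_pow_mul]
    rw [bz8]
    have e60 : (if 60 ≤ 4 * (4 * (i:ℕ) + j) + k then bz Er.r2 (4 * (4 * (i:ℕ) + j) + k - 60) else 0) = (if i = 3 ∧ j = 3 then Sm br dr 2 k else 0) := by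
      by_cases h : i = 3 ∧ j = 3
      · obtain ⟨rfl, rfl⟩ := h
        have h3 : ((3 : Fin 4) : ℕ) = 3 := rfl
        rw [if_pos (by rw [h3]; omega), if_pos ⟨rfl, rfl⟩, ← hr2]; congr 1; rw [h3]; omega
      · rw [if_neg h, if_neg]
        intro h'
        apply h
        constructor <;> apply Fin.ext <;> simp <;> omega
    rw [e60, Lh]
    by_cases h : k = 3 <;> simp [h]
  have bY : ∀ i j k : Fin 4, bz Y (16 * i + 4 * j + k) = Lh e e2 (Sm b0 d0) (Sm b1 d1) (Sm br dr) (Sm b3 d3) k j i := by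
    intro i j k
    have hn : (16 * (i : ℕ) + 4 * j + k) = 16 * i + (4 * j + k) := by ring
    have hij : 4 * (j:ℕ) + k < 16 := by omega
    rw [hY, bz_xr, bz_xr, bz_mul he, bz_xr, bz_mul he2, h32, h48, hn]
    rw [bz_spread 16 _ _ 4 _ _ ha0 i.2 hij, bz_spread 16 _ _ 4 _ _ ha1 i.2 hij, bz_spread 16 _ _ 4 _ _ (by norm_num) i.2 hij, hpa0, hpa1, bz_pk, bz_pk, hr0, hr1, hr2, bz_pow_mul]
    rw [bz32768]
    have e48 : (if 48 ≤ 16 * (i:ℕ) + (4 * j + k) then bz E3.a (16 * (i:ℕ) + (4 * j + k) - 48) else 0) = (if i = 3 then Sm b3 d3 k j else 0) := by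
      by_cases h : i = 3
      · subst h
        have h3 : ((3 : Fin 4) : ℕ) = 3 := rfl
        rw [if_pos (by rw [h3]; omega), if_pos rfl, Sm_symm, ← bz_pk, hpa3]; congr 1; rw [h3]; omega
      · rw [if_neg h, if_neg]
        intro h'
        apply h
        apply Fin.ext; simp; omega
    rw [e48, Lh, Sm_symm b0 d0 j k, Sm_symm b1 d1 j k]
    by_cases h : k = 3 ∧ j = 3 <;> simp [h] <;> ring
  rw [hXY]
  constructor
  · intro h i j k
    rw [← bX, ← bY, h]
  · intro h
    apply bz_inj 64 hXl hYl
    intro n hn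
    have := h ⟨n / 16, by omega⟩ ⟨n / 4 % 4, by omega⟩ ⟨n % 4, by omega⟩
    rw [← bX, ← bY] at this
    have hnn : 16 * (n / 16) + 4 * (n / 4 % 4) + n % 4 = n := by omega
    simpa [hnn] using this
theorem asc_iff {e e2 : ℕ} (he : e ≤ 1) (he2 : e2 ≤ 1) (d0 b0 d1 b1 dr br d3 b3 : ℕ) :
   asc e e2 (ent d0 b0) (ent d1 b1) (ent dr br) (ent d3 b3) = true ↔
   ∀ i j k, Lh e e2 (Sm b0 d0) (Sm b1 d1) (Sm br dr) (Sm b3 d3) i j k = Lh e e2 (Sm b0 d0) (Sm b1 d1) (Sm br dr) (Sm b3 d3) k j i := by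
  have h0 : (ent dr br).r0 = Nat.land (pk br dr) 15 := by simp only [ent]
  have h1 : (ent dr br).r1 = Nat.land (Nat.shiftRight (pk br dr) 4) 15 := by simp only [ent]
  have h2 : (ent dr br).r2 = Nat.land (Nat.shiftRight (pk br dr) 8) 15 := by simp only [ent]
  have h3 : (ent dr br).t0 = mk 16 (bt (ent dr br).r0) 4 := by simp only [ent]
  have h4 : (ent dr br).t1 = mk 16 (bt (ent dr br).r1) 4 := by simp only [ent]
  have h5 : (ent dr br).t2 = mk 16 (bt (ent dr br).r2) 4 := by simp only [ent]
  have hs : ∀ d b, (ent d b).s = mk 4 (bt (pk b d)) 16 := fun _ _ => by simp only [ent]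
  have ha : ∀ d b, (ent d b).a = pk b d := fun _ _ => by simp only [ent]
  have hs0 := hs d0 b0
  have hs1 := hs d1 b1
  have hs3 := hs d3 b3
  have ha0 := ha d0 b0
  have ha1 := ha d1 b1
  have ha3 := ha d3 b3
  clear hs ha
  generalize ent dr br = Er at *
  generalize ent d0 b0 = E0 at *
  generalize ent d1 b1 = E1 at *
  generalize ent d3 b3 = E3 at *
  have k0 : ∀ k : Fin 4, bz Er.r0 k = Sm br dr 0 k := by
    intro k
    rw [← bz_pk, h0, bz_land15 _ _ k.2]; congr 1; simp
  have k1 : ∀ k : Fin 4, bz Er.r1 k = Sm br dr 1 k := by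
    intro k
    rw [← bz_pk, h1, bz_land15 _ _ k.2, bz_shr]; congr 1
  have k2 : ∀ k : Fin 4, bz Er.r2 k = Sm br dr 2 k := by
    intro k
    rw [← bz_pk, h2, bz_land15 _ _ k.2, bz_shr]; congr 1
  exact asc_gen he he2 E0 E1 Er E3 d0 b0 d1 b1 dr br d3 b3 k0 k1 k2 hs0 hs1 hs3 h3 h4 h5 ha0 ha1 ha3
    (h0 ▸ land15_lt _) (h1 ▸ land15_lt _) (h2 ▸ land15_lt _)
end BR
namespace BR
structure Th where
  (p q r s P Q R S k1 k2 l1 l2 x y z w : ZMod 2)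
noncomputable section
def gp0 (ep p q r s P Q R S k1 k2 l1 l2 x y z w : ℕ) : GP :=
  let a := enc4 s q 0 0
  let b := enc4 r p 0 0
  let u := mn S Q l1 k1
  let v := mn S Q l2 k2
  let u' := mn R P l1 k1
  let v' := mn R P l2 k2
  let c := enc4 (mn u v r s) (mn u v p q) S Q
  let d := enc4 (mn u' v' r s) (mn u' v' p q) R P
  ⟨mkTB a b c d, mkDB a b c d, mkFB a b c d, p,q,r,s,x,y,z,w,P,Q,R,S, Nat.mul ep (enc6 0 0 (mn s q w y) 0 (mn r p w y) 0)⟩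
def gp (ep : ℕ) (t : Th) : GP := gp0 ep t.p.val t.q.val t.r.val t.s.val t.P.val t.Q.val t.R.val t.S.val t.k1.val t.k2.val t.l1.val t.l2.val t.x.val t.y.val t.z.val t.w.val
theorem mem_mkG (ep : ℕ) (E F : ℕ × ℕ × ℕ × ℕ) (K L : ℕ × ℕ) (XX) (g : GP) : g ∈ mkG ep E F K L XX ↔
   ∃ X ∈ XX, g = gp0 ep E.1 E.2.1 E.2.2.1 E.2.2.2 F.1 F.2.1 F.2.2.1 F.2.2.2 K.1 K.2 L.1 L.2 X.1.1 X.1.2 X.2.1 X.2.2 := by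
  obtain ⟨p,q,r,s⟩ := E
  obtain ⟨P,Q,R,S⟩ := F
  obtain ⟨k1,k2⟩ := K
  obtain ⟨l1,l2⟩ := L
  simp only [mkG, frc_eq, List.mem_map, gp0]
  constructor
  · rintro ⟨⟨⟨x,y⟩,⟨z,w⟩⟩, h, rfl⟩
    exact ⟨_, h, rfl⟩
  · rintro ⟨⟨⟨x,y⟩,⟨z,w⟩⟩, h, rfl⟩
    exact ⟨_, h, rfl⟩
def v2 (a : ZMod 2 × ZMod 2) : ℕ × ℕ := (a.1.val, a.2.val)
def v4 (a : ZMod 2 × ZMod 2 × ZMod 2 × ZMod 2) : ℕ × ℕ × ℕ × ℕ := (a.1.val, a.2.1.val, a.2.2.1.val, a.2.2.2.val)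
theorem mem_mkT (ep : ℕ) (Es Fs Ks Xs) (pE pF : ZMod 2 → ZMod 2 → ZMod 2 → ZMod 2 → Prop) (pK pX : ZMod 2 → ZMod 2 → Prop)
  (hE : ∀ E, E ∈ Es ↔ ∃ a b c d : ZMod 2, pE a b c d ∧ E = (a.val, b.val, c.val, d.val))
  (hF : ∀ E, E ∈ Fs ↔ ∃ a b c d : ZMod 2, pF a b c d ∧ E = (a.val, b.val, c.val, d.val))
  (hK : ∀ E, E ∈ Ks ↔ ∃ a b : ZMod 2, pK a b ∧ E = (a.val, b.val))
  (hX : ∀ E, E ∈ Xs ↔ ∃ a b : ZMod 2, pX a b ∧ E = (a.val, b.val))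
  (hB : ∀ E, E ∈ Bt ↔ ∃ a b : ZMod 2, E = (a.val, b.val)) (g : GP) :
  g ∈ mkT ep Es Fs Ks Xs ↔ ∃ t : Th, (pE t.p t.q t.r t.s ∧ pF t.P t.Q t.R t.S ∧ pK t.k1 t.k2 ∧ pX t.x t.y) ∧ g = gp ep t := by
  simp only [mkT, List.mem_flatMap, mem_mkG, List.mem_map]
  constructor
  · rintro ⟨E, h1, F, h2, K, h3, L, h4, X, ⟨X1, h5, Y, h6, rfl⟩, rfl⟩
    obtain ⟨p,q,r,s,g1,rfl⟩ := (hE _).1 h1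
    obtain ⟨P,Q,R,S,g2,rfl⟩ := (hF _).1 h2
    obtain ⟨k1,k2,g3,rfl⟩ := (hK _).1 h3
    obtain ⟨l1,l2,rfl⟩ := (hB _).1 h4
    obtain ⟨x,y,g5,rfl⟩ := (hX _).1 h5
    obtain ⟨z,w,rfl⟩ := (hB _).1 h6
    exact ⟨⟨p,q,r,s,P,Q,R,S,k1,k2,l1,l2,x,y,z,w⟩, ⟨g1,g2,g3,g5⟩, rfl⟩
  · rintro ⟨⟨p,q,r,s,P,Q,R,S,k1,k2,l1,l2,x,y,z,w⟩, ⟨h1,h2,h3,h5⟩, rfl⟩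
    exact ⟨_, (hE _).2 ⟨p,q,r,s,h1,rfl⟩, _, (hF _).2 ⟨P,Q,R,S,h2,rfl⟩, _, (hK _).2 ⟨k1,k2,h3,rfl⟩, _, (hB _).2 ⟨l1,l2,rfl⟩, _,
      ⟨_, (hX _).2 ⟨x,y,h5,rfl⟩, _, (hB _).2 ⟨z,w,rfl⟩, rfl⟩, rfl⟩
end
theorem hGL (E) : E ∈ GLs ↔ ∃ a b c d : ZMod 2, a * d + b * c = 1 ∧ E = (a.val, b.val, c.val, d.val) := by
  constructor
  · have : ∀ E ∈ GLs, ∃ a b c d : ZMod 2, a * d + b * c = 1 ∧ E = (a.val, b.val, c.val, d.val) := by decide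
    exact this E
  · rintro ⟨a,b,c,d,h,rfl⟩; revert a b c d; decide
theorem hF1 (E) : E ∈ [(1,0,0,1),(1,0,1,1)] ↔ ∃ a b c d : ZMod 2, (a = 1 ∧ b = 0 ∧ d = 1) ∧ E = (a.val, b.val, c.val, d.val) := by
  constructor
  · have : ∀ E ∈ [(1,0,0,1),(1,0,1,1)], ∃ a b c d : ZMod 2, (a = 1 ∧ b = 0 ∧ d = 1) ∧ E = (a.val, b.val, c.val, d.val) := by decide
    exact this E
  · rintro ⟨a,b,c,d,h,rfl⟩; revert a b c d; decide
theorem hBt (E) : E ∈ Bt ↔ ∃ a b : ZMod 2, E = (a.val, b.val) := by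
  constructor
  · have : ∀ E ∈ Bt, ∃ a b : ZMod 2, E = (a.val, b.val) := by decide
    exact this E
  · rintro ⟨a,b,rfl⟩; revert a b; decide
theorem hBt' (E) : E ∈ Bt ↔ ∃ a b : ZMod 2, True ∧ E = (a.val, b.val) := by
  simp only [true_and]; exact hBt E
theorem h00 (E) : E ∈ [(0,0)] ↔ ∃ a b : ZMod 2, (a = 0 ∧ b = 0) ∧ E = (a.val, b.val) := by
  constructor
  · intro h; simp at h; exact ⟨0,0,⟨rfl,rfl⟩,h⟩
  · rintro ⟨a,b,⟨rfl,rfl⟩,rfl⟩; decide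
inductive Tg | t8 | t1 | t4
def okT : Tg → Th → Prop
  | .t8, t => t.p * t.s + t.q * t.r = 1 ∧ (t.P = 1 ∧ t.Q = 0 ∧ t.S = 1)
  | .t1, t => (t.p = 1 ∧ t.q = 0 ∧ t.s = 1) ∧ t.P * t.S + t.Q * t.R = 1 ∧ (t.x = 0 ∧ t.y = 0)
  | .t4, t => t.p * t.s + t.q * t.r = 1 ∧ (t.P = 1 ∧ t.Q = 0 ∧ t.S = 1) ∧ (t.k1 = 0 ∧ t.k2 = 0)
def epT : Tg → ℕ | .t8 => 0 | .t1 => 0 | .t4 => 1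
noncomputable def TT : Tg → List GP | .t8 => T8 | .t1 => T1 | .t4 => T4
theorem mem_TT (τ : Tg) (g : GP) : g ∈ TT τ ↔ ∃ t, okT τ t ∧ g = gp (epT τ) t := by
  cases τ
  · refine (mem_mkT 0 _ _ _ _ _ _ _ _ hGL hF1 hBt' hBt' hBt g).trans ?_
    simp [okT, epT]
  · refine (mem_mkT 0 _ _ _ _ _ _ _ _ hF1 hGL hBt' h00 hBt g).trans ?_
    simp [okT, epT]
  · refine (mem_mkT 1 _ _ _ _ _ _ _ _ hGL hF1 h00 hBt' hBt g).trans ?_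
    simp [okT, epT]
def alz (t : Th) : Fin 4 → Fin 4 → ZMod 2 :=
  ![![t.s, t.q, 0, 0], ![t.r, t.p, 0, 0],
    ![(t.S * t.k1 + t.Q * t.l1) * t.s + (t.S * t.k2 + t.Q * t.l2) * t.r, (t.S * t.k1 + t.Q * t.l1) * t.q + (t.S * t.k2 + t.Q * t.l2) * t.p, t.S, t.Q],
    ![(t.R * t.k1 + t.P * t.l1) * t.s + (t.R * t.k2 + t.P * t.l2) * t.r, (t.R * t.k1 + t.P * t.l1) * t.q + (t.R * t.k2 + t.P * t.l2) * t.p, t.R, t.P]]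
def exz (t : Th) : Fin 6 → ZMod 2 := ![0, 0, t.s * t.y + t.q * t.w, 0, t.r * t.y + t.p * t.w, 0]
theorem vle (a : ZMod 2) : a.val ≤ 1 := by have := ZMod.val_lt a; omega
theorem vc (a : ZMod 2) : ((a.val : ℕ) : ZMod 2) = a := ZMod.natCast_zmod_val a
def Qf (Sr : Fin 4 → Fin 4 → ZMod 2) (u v : Fin 4 → ZMod 2) : ZMod 2 := ∑ k, ∑ l, Sr k l * u k * v l
theorem act_bits {ep : ℕ} (hep : ep ≤ 1) (t : Th) {f b0 b1 b2 b3 f' b0' b1' b2' b3' d0 d2 d3 : ℕ}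
  (hf : f < 16) (h0 : b0 < 64) (h1 : b1 < 64) (h2 : b2 < 64) (h3 : b3 < 64)
  (hf' : f' < 16) (h0' : b0' < 64) (h1' : b1' < 64) (h2' : b2' < 64) (h3' : b3' < 64)
  (hd0 : d0 < 16) (hd2 : d2 < 16) (hd3 : d3 < 16)
  (ef : ∀ n : Fin 4, bz f' n = ∑ k : Fin 4, bz f k * alz t n k)
  (e0 : ∀ n : Fin 6, bz b0' n = t.p * Qf (Sm b0 d0) (alz t (pi n)) (alz t (pj n)) + t.r * Qf (Sm b1 0) (alz t (pi n)) (alz t (pj n)))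
  (e1 : ∀ n : Fin 6, bz b1' n = t.q * Qf (Sm b0 d0) (alz t (pi n)) (alz t (pj n)) + t.s * Qf (Sm b1 0) (alz t (pi n)) (alz t (pj n)))
  (e2 : ∀ n : Fin 6, bz b2' n = t.x * Qf (Sm b0 d0) (alz t (pi n)) (alz t (pj n)) + t.z * Qf (Sm b1 0) (alz t (pi n)) (alz t (pj n))
     + t.P * Qf (Sm b2 d2) (alz t (pi n)) (alz t (pj n)) + t.R * Qf (Sm b3 d3) (alz t (pi n)) (alz t (pj n)) + t.P * (ep * exz t n))
  (e3 : ∀ n : Fin 6, bz b3' n = t.y * Qf (Sm b0 d0) (alz t (pi n)) (alz t (pj n)) + t.w * Qf (Sm b1 0) (alz t (pi n)) (alz t (pj n))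
     + t.Q * Qf (Sm b2 d2) (alz t (pi n)) (alz t (pj n)) + t.S * Qf (Sm b3 d3) (alz t (pi n)) (alz t (pj n)) + t.Q * (ep * exz t n)) :
  lk4 (gp ep t).fb f = f' ∧ aB b0 b1 d0 0 (gp ep t) = 64 * b1' + b0' ∧ aE b2 b3 (toE b0 b1 d0 0 d2 d3 (gp ep t)) = 64 * b3' + b2' := by
  obtain ⟨a, b, c, d, hal, htb, hdb, hfb⟩ : ∃ a b c d : ℕ, al a b c d = alz t ∧ (gp ep t).tb = mkTB a b c d ∧ (gp ep t).db = mkDB a b c d ∧ (gp ep t).fb = mkFB a b c d := by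
    refine ⟨_, _, _, _, ?_, rfl, rfl, rfl⟩
    have A0 := bz_enc4 (vle t.s) (vle t.q) (Nat.zero_le 1) (Nat.zero_le 1)
    have A1 := bz_enc4 (vle t.r) (vle t.p) (Nat.zero_le 1) (Nat.zero_le 1)
    have A2 := bz_enc4 (mn_le (mn t.S.val t.Q.val t.l1.val t.k1.val) (mn t.S.val t.Q.val t.l2.val t.k2.val) t.r.val t.s.val)
       (mn_le (mn t.S.val t.Q.val t.l1.val t.k1.val) (mn t.S.val t.Q.val t.l2.val t.k2.val) t.p.val t.q.val) (vle t.S) (vle t.Q)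
    have A3 := bz_enc4 (mn_le (mn t.R.val t.P.val t.l1.val t.k1.val) (mn t.R.val t.P.val t.l2.val t.k2.val) t.r.val t.s.val)
       (mn_le (mn t.R.val t.P.val t.l1.val t.k1.val) (mn t.R.val t.P.val t.l2.val t.k2.val) t.p.val t.q.val) (vle t.R) (vle t.P)
    simp only [mn_cast, vc, Nat.cast_zero] at A0 A1 A2 A3
    funext i j
    fin_cases i <;> fin_cases j
    exacts [A0.1, A0.2.1, A0.2.2.1, A0.2.2.2, A1.1, A1.2.1, A1.2.2.1, A1.2.2.2, A2.1, A2.2.1, A2.2.2.1, A2.2.2.2, A3.1, A3.2.1, A3.2.2.1, A3.2.2.2]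
  have hQ : ∀ (x y : ℕ), x < 64 → y < 16 → ∀ n : Fin 6, bz (aX (gp ep t).tb (gp ep t).db x y) n = Qf (Sm x y) (alz t (pi n)) (alz t (pj n)) := by
    intro x y hx hy n
    rw [htb, hdb, bz_aX _ _ _ _ hx hy, hal]; rfl
  have hX6 : ∀ x y, aX (gp ep t).tb (gp ep t).db x y < 2 ^ 6 := fun x y => xr_lt 6 (lk6_lt _ _) (lk6_lt _ _)
  have hXd : ∀ x y, aX (gp ep t).tb (gp ep t).db x y = xr (lk6 (gp ep t).tb x) (lk6 (gp ep t).db y) := fun _ _ => rfl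
  have hexl : (gp ep t).ex < 2 ^ 6 := ml_lt 6 hep (enc6_lt (by omega) (by omega) (mn_le _ _ _ _) (by omega) (mn_le _ _ _ _) (by omega))
  have hex : ∀ n : Fin 6, bz (gp ep t).ex n = ep * exz t n := by
    intro n
    have hh : (gp ep t).ex = Nat.mul ep (enc6 0 0 (mn t.s.val t.q.val t.w.val t.y.val) 0 (mn t.r.val t.p.val t.w.val t.y.val) 0) := rfl
    rw [hh, bz_mul hep]
    congr 1
    have A := bz_enc6 (Nat.zero_le 1) (Nat.zero_le 1) (mn_le t.s.val t.q.val t.w.val t.y.val) (Nat.zero_le 1) (mn_le t.r.val t.p.val t.w.val t.y.val) (Nat.zero_le 1)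
    simp only [mn_cast, vc, Nat.cast_zero] at A
    fin_cases n
    exacts [A.1, A.2.1, A.2.2.1, A.2.2.2.1, A.2.2.2.2.1, A.2.2.2.2.2]
  have hp : (gp ep t).p = t.p.val := rfl
  have hq : (gp ep t).q = t.q.val := rfl
  have hr : (gp ep t).r = t.r.val := rfl
  have hs : (gp ep t).s = t.s.val := rfl
  have hx : (gp ep t).x = t.x.val := rfl
  have hy : (gp ep t).y = t.y.val := rfl
  have hz : (gp ep t).z = t.z.val := rfl
  have hw : (gp ep t).w = t.w.val := rfl
  have hP : (gp ep t).P = t.P.val := rfl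
  have hQQ : (gp ep t).Q = t.Q.val := rfl
  have hR : (gp ep t).R = t.R.val := rfl
  have hS : (gp ep t).S = t.S.val := rfl
  generalize gp ep t = G at *
  refine ⟨?_, ?_, ?_⟩
  · apply bz_inj 4 (lk4_lt _ _) hf'
    intro n hn
    have := bz_fb a b c d hf ⟨n, hn⟩
    rw [hal, ← hfb] at this
    rw [this]
    exact (ef ⟨n, hn⟩).symm
  · simp only [aB, frc_eq, Nat.add_eq, hp, hq, hr, hs]
    rw [Nat.mul_eq]
    congr 1
    · congr 1
      apply bz_inj 6 (xr_lt 6 (ml_lt 6 (vle _) (hX6 _ _)) (ml_lt 6 (vle _) (hX6 _ _))) h1'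
      intro n hn
      have E := e1 ⟨n, hn⟩
      have q0 := hQ b0 d0 h0 hd0 ⟨n, hn⟩
      have q1 := hQ b1 0 h1 (by omega) ⟨n, hn⟩
      simp only at E q0 q1
      rw [E, ← q0, ← q1]
      simp only [bz_xr, bz_mul (vle _), vc]
    · apply bz_inj 6 (xr_lt 6 (ml_lt 6 (vle _) (hX6 _ _)) (ml_lt 6 (vle _) (hX6 _ _))) h0'
      intro n hn
      have E := e0 ⟨n, hn⟩
      have q0 := hQ b0 d0 h0 hd0 ⟨n, hn⟩
      have q1 := hQ b1 0 h1 (by omega) ⟨n, hn⟩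
      simp only at E q0 q1
      rw [E, ← q0, ← q1]
      simp only [bz_xr, bz_mul (vle _), vc]
  · simp only [aE, toE, frc_eq, Nat.add_eq, hx, hy, hz, hw, hP, hQQ, hR, hS]
    rw [Nat.mul_eq]
    have g6 : ∀ x, lk6 G.tb x < 2 ^ 6 := fun x => lk6_lt _ _
    have g6' : ∀ x, lk6 G.db x < 2 ^ 6 := fun x => lk6_lt _ _
    congr 1
    · congr 1
      apply bz_inj 6 _ h3'
      · intro n hn
        have E := e3 ⟨n, hn⟩
        have q0 := hQ b0 d0 h0 hd0 ⟨n, hn⟩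
        have q1 := hQ b1 0 h1 (by omega) ⟨n, hn⟩
        have q2 := hQ b2 d2 h2 hd2 ⟨n, hn⟩
        have q3 := hQ b3 d3 h3 hd3 ⟨n, hn⟩
        rw [hXd, bz_xr] at q2 q3
        have q4 := hex ⟨n, hn⟩
        simp only at E q0 q1 q2 q3 q4
        rw [E, ← q2, ← q3, ← q0, ← q1, ← q4]
        simp only [bz_xr, bz_mul (vle _), vc]; ring
      · repeat' first | apply xr_lt | apply ml_lt _ (vle _) | apply hX6 | apply g6 | apply g6' | apply hexl
    · apply bz_inj 6 _ h2'
      · intro n hn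
        have E := e2 ⟨n, hn⟩
        have q0 := hQ b0 d0 h0 hd0 ⟨n, hn⟩
        have q1 := hQ b1 0 h1 (by omega) ⟨n, hn⟩
        have q2 := hQ b2 d2 h2 hd2 ⟨n, hn⟩
        have q3 := hQ b3 d3 h3 hd3 ⟨n, hn⟩
        rw [hXd, bz_xr] at q2 q3
        have q4 := hex ⟨n, hn⟩
        simp only at E q0 q1 q2 q3 q4
        rw [E, ← q2, ← q3, ← q0, ← q1, ← q4]
        simp only [bz_xr, bz_mul (vle _), vc]; ring
      · repeat' first | apply xr_lt | apply ml_lt _ (vle _) | apply hX6 | apply g6 | apply g6' | apply hexl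
end BR
namespace BR
structure Cd where
  f : ℕ
  b : Fin 4 → ℕ
def okF : Tg → ℕ → Prop
  | .t8, f => 1 ≤ f
  | .t1, f => 1 ≤ f ∧ f % 2 = 0
  | .t4, f => f = 0
def d0T : Tg → ℕ → ℕ | .t8, _ => 0 | .t1, f => f | .t4, _ => 0
def d2T : Tg → ℕ → ℕ | .t8, f => xr 4 f | .t1, _ => 4 | .t4, _ => 4
def ddT (τ : Tg) (f : ℕ) : Fin 4 → ℕ := ![d0T τ f, 0, d2T τ f, 8]
structure Cd.ok (τ : Tg) (c : Cd) : Prop where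
  f16 : c.f < 16
  okf : okF τ c.f
  b64 : ∀ r, c.b r < 64
def Cd.S (τ : Tg) (c : Cd) (r : Fin 4) : Fin 4 → Fin 4 → ZMod 2 := Sm (c.b r) (ddT τ c.f r)
def Cd.L (τ : Tg) (c : Cd) (r i j k : Fin 4) : ZMod 2 :=
  c.S τ 0 i j * c.S τ r 0 k + c.S τ 1 i j * c.S τ r 1 k + (epT τ : ZMod 2) * ((if i = 3 ∧ j = 3 then c.S τ r 2 k else 0) + 
   if r = 2 then (if k = 3 then c.S τ 3 i j else 0) else 0)
def Cd.Asc (τ : Tg) (c : Cd) : Prop := ∀ r i j k, c.L τ r i j k = c.L τ r k j i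
def Cd.key (c : Cd) : ℕ := BR.key c.f (64 * c.b 1 + c.b 0) (64 * c.b 3 + c.b 2)
noncomputable def Cd.act (τ : Tg) (c : Cd) (t : Th) : ℕ :=
  BR.key (lk4 (gp (epT τ) t).fb c.f) (aB (c.b 0) (c.b 1) (d0T τ c.f) 0 (gp (epT τ) t))
    (aE (c.b 2) (c.b 3) (toE (c.b 0) (c.b 1) (d0T τ c.f) 0 (d2T τ c.f) 8 (gp (epT τ) t)))
noncomputable def EE : Tg → List ℕ | .t8 => e8 | .t1 => e1 | .t4 => e4
theorem mem_EE0 (τ : Tg) (z : ℕ) : z ∈ EE τ ↔ ∃ f < 16, okF τ f ∧ (∀ g ∈ TT τ, f ≤ lk4 g.fb f) ∧ ∃ b1 < 64, ∃ b0 < 64, 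
   (asc (epT τ) 0 (ent (d0T τ f) b0) (ent 0 b1) (ent (d0T τ f) b0) (ent (d0T τ f) b0) = true ∧ asc (epT τ) 0 (ent (d0T τ f) b0) (ent 0 b1) (ent 0 b1) (ent 0 b1) = true) ∧
   (∀ g ∈ TT τ, lk4 g.fb f = f → 64 * b1 + b0 ≤ aB b0 b1 (d0T τ f) 0 g) ∧
   ∃ b3 < 64, asc (epT τ) 0 (ent (d0T τ f) b0) (ent 0 b1) (ent 8 b3) (ent 8 b3) = true ∧ ∃ b2 < 64, asc (epT τ) 1 (ent (d0T τ f) b0) (ent 0 b1) (ent (d2T τ f) b2) (ent 8 b3) = true ∧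
   (∀ g ∈ TT τ, lk4 g.fb f = f → aB b0 b1 (d0T τ f) 0 g = 64 * b1 + b0 → 64 * b3 + b2 ≤ aE b2 b3 (toE b0 b1 (d0T τ f) 0 (d2T τ f) 8 g)) ∧
   z = key f (64 * b1 + b0) (64 * b3 + b2) := by
  cases τ
  · have := mem_eng 0 (Nat.ble 1) (fun _ => 0) (fun f => xr 4 f) T8 z
    simp only [Nat.ble_eq] at this
    exact this
  · have := mem_eng 0 (fun f => and (Nat.ble 1 f) (Nat.beq (Nat.mod f 2) 0)) (fun f => f) (fun _ => 4) T1 z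
    simp only [Bool.and_eq_true, Nat.ble_eq, Nat.beq_eq] at this
    exact this
  · have := mem_eng 1 (Nat.beq 0) (fun _ => 0) (fun _ => 4) T4 z
    simp only [Nat.beq_eq, eq_comm (a := 0)] at this
    exact this
theorem ascs_iff (τ : Tg) (c : Cd) : c.Asc τ ↔ 
   (asc (epT τ) 0 (ent (d0T τ c.f) (c.b 0)) (ent 0 (c.b 1)) (ent (d0T τ c.f) (c.b 0)) (ent (d0T τ c.f) (c.b 0)) = true ∧ 
    asc (epT τ) 0 (ent (d0T τ c.f) (c.b 0)) (ent 0 (c.b 1)) (ent 0 (c.b 1)) (ent 0 (c.b 1)) = true) ∧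
   asc (epT τ) 0 (ent (d0T τ c.f) (c.b 0)) (ent 0 (c.b 1)) (ent 8 (c.b 3)) (ent 8 (c.b 3)) = true ∧
   asc (epT τ) 1 (ent (d0T τ c.f) (c.b 0)) (ent 0 (c.b 1)) (ent (d2T τ c.f) (c.b 2)) (ent 8 (c.b 3)) = true := by
  have he : epT τ ≤ 1 := by cases τ <;> decide
  rw [asc_iff he (by omega), asc_iff he (by omega), asc_iff he (by omega), asc_iff he (by omega)]
  have h4 : ∀ P : Fin 4 → Prop, (∀ r, P r) ↔ (P 0 ∧ P 1) ∧ P 3 ∧ P 2 := by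
    intro P
    constructor
    · intro h; exact ⟨⟨h 0, h 1⟩, h 3, h 2⟩
    · rintro ⟨⟨h0, h1⟩, h3, h2⟩ r
      fin_cases r <;> assumption
  unfold Cd.Asc
  rw [h4]
  have e0 : ∀ i j k, c.L τ 0 i j k = Lh (epT τ) 0 (Sm (c.b 0) (d0T τ c.f)) (Sm (c.b 1) 0) (Sm (c.b 0) (d0T τ c.f)) (Sm (c.b 0) (d0T τ c.f)) i j k := by
    intro i j k; simp [Cd.L, Lh, Cd.S, ddT]
  have e1 : ∀ i j k, c.L τ 1 i j k = Lh (epT τ) 0 (Sm (c.b 0) (d0T τ c.f)) (Sm (c.b 1) 0) (Sm (c.b 1) 0) (Sm (c.b 1) 0) i j k := by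
    intro i j k; simp [Cd.L, Lh, Cd.S, ddT]
  have e3 : ∀ i j k, c.L τ 3 i j k = Lh (epT τ) 0 (Sm (c.b 0) (d0T τ c.f)) (Sm (c.b 1) 0) (Sm (c.b 3) 8) (Sm (c.b 3) 8) i j k := by
    intro i j k; simp [Cd.L, Lh, Cd.S, ddT]
  have e2 : ∀ i j k, c.L τ 2 i j k = Lh (epT τ) 1 (Sm (c.b 0) (d0T τ c.f)) (Sm (c.b 1) 0) (Sm (c.b 2) (d2T τ c.f)) (Sm (c.b 3) 8) i j k := by
    intro i j k; simp [Cd.L, Lh, Cd.S, ddT]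
  simp only [e0, e1, e2, e3]
theorem key_le (f b g f' b' g' : ℕ) (hb : b < 4096) (hg : g < 4096) (hb' : b' < 4096) (hg' : g' < 4096) :
   key f b g ≤ key f' b' g' ↔ f ≤ f' ∧ (f' = f → b ≤ b') ∧ (f' = f → b' = b → g ≤ g') := by
  have h1 : key f b g = 4096 * (4096 * f + b) + g := rfl
  have h2 : key f' b' g' = 4096 * (4096 * f' + b') + g' := rfl
  rw [h1, h2]
  constructor
  · intro h
    refine ⟨by omega, fun h => by omega, fun h _ => by omega⟩
  · rintro ⟨h1, h2, h3⟩
    rcases Nat.lt_or_ge f f' with h | h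
    · omega
    · have : f' = f := by omega
      have := h2 this
      rcases Nat.lt_or_ge b b' with h | h
      · omega
      · have := h3 (by omega) (by omega)
        omega
theorem key_inj (c c' : Cd) (h : ∀ r, c.b r < 64) (h' : ∀ r, c'.b r < 64) (hk : c.key = c'.key) : c = c' := by
  have h1 : c.key = 4096 * (4096 * c.f + (64 * c.b 1 + c.b 0)) + (64 * c.b 3 + c.b 2) := rfl
  have h2 : c'.key = 4096 * (4096 * c'.f + (64 * c'.b 1 + c'.b 0)) + (64 * c'.b 3 + c'.b 2) := rfl
  have := h 0; have := h 1; have := h 2; have := h 3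
  have := h' 0; have := h' 1; have := h' 2; have := h' 3
  have : c.f = c'.f := by omega
  have e0 : c.b 0 = c'.b 0 := by omega
  have e1 : c.b 1 = c'.b 1 := by omega
  have e2 : c.b 2 = c'.b 2 := by omega
  have e3 : c.b 3 = c'.b 3 := by omega
  obtain ⟨f, b⟩ := c
  obtain ⟨f', b'⟩ := c'
  simp only at *
  subst this
  congr 1
  funext r; fin_cases r <;> assumption
theorem aB_lt (b0 b1 d0 d1 : ℕ) (t : Th) (ep : ℕ) : aB b0 b1 d0 d1 (gp ep t) < 4096 := by
  have h : ∀ x y, aX (gp ep t).tb (gp ep t).db x y < 2 ^ 6 := fun x y => xr_lt 6 (lk6_lt _ _) (lk6_lt _ _)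
  have hp : (gp ep t).p = t.p.val := rfl
  have hq : (gp ep t).q = t.q.val := rfl
  have hr : (gp ep t).r = t.r.val := rfl
  have hs : (gp ep t).s = t.s.val := rfl
  generalize gp ep t = G at *
  simp only [aB, frc_eq, Nat.add_eq, hp, hq, hr, hs]
  rw [Nat.mul_eq]
  have h1 := xr_lt 6 (ml_lt 6 (vle t.q) (h b0 d0)) (ml_lt 6 (vle t.s) (h b1 d1))
  have h2 := xr_lt 6 (ml_lt 6 (vle t.p) (h b0 d0)) (ml_lt 6 (vle t.r) (h b1 d1))
  omega
theorem aE_lt (b0 b1 b2 b3 d0 d1 d2 d3 : ℕ) (t : Th) {ep : ℕ} (hep : ep ≤ 1) : aE b2 b3 (toE b0 b1 d0 d1 d2 d3 (gp ep t)) < 4096 := by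
  have hX6 : ∀ x y, aX (gp ep t).tb (gp ep t).db x y < 2 ^ 6 := fun x y => xr_lt 6 (lk6_lt _ _) (lk6_lt _ _)
  have hexl : (gp ep t).ex < 2 ^ 6 := ml_lt 6 hep (enc6_lt (by omega) (by omega) (mn_le _ _ _ _) (by omega) (mn_le _ _ _ _) (by omega))
  have hx : (gp ep t).x = t.x.val := rfl
  have hy : (gp ep t).y = t.y.val := rfl
  have hz : (gp ep t).z = t.z.val := rfl
  have hw : (gp ep t).w = t.w.val := rfl
  have hP : (gp ep t).P = t.P.val := rfl
  have hQQ : (gp ep t).Q = t.Q.val := rfl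
  have hR : (gp ep t).R = t.R.val := rfl
  have hS : (gp ep t).S = t.S.val := rfl
  generalize gp ep t = G at *
  simp only [aE, toE, frc_eq, Nat.add_eq, hx, hy, hz, hw, hP, hQQ, hR, hS]
  rw [Nat.mul_eq]
  have g6 : ∀ x, lk6 G.tb x < 2 ^ 6 := fun x => lk6_lt _ _
  have g6' : ∀ x, lk6 G.db x < 2 ^ 6 := fun x => lk6_lt _ _
  have aux : ∀ x y : ℕ, x < 2 ^ 6 → y < 2 ^ 6 → 64 * x + y < 4096 := by intros; omega
  apply aux
  · repeat' first | apply xr_lt | apply ml_lt _ (vle _) | apply hX6 | apply g6 | apply g6' | apply hexl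
  · repeat' first | apply xr_lt | apply ml_lt _ (vle _) | apply hX6 | apply g6 | apply g6' | apply hexl
theorem mem_EE (τ : Tg) (z : ℕ) : z ∈ EE τ ↔ ∃ c : Cd, c.ok τ ∧ c.Asc τ ∧ (∀ t, okT τ t → c.key ≤ c.act τ t) ∧ z = c.key := by
  have he : epT τ ≤ 1 := by cases τ <;> decide
  rw [mem_EE0]
  have L : ∀ c : Cd, c.ok τ → ∀ t, (c.key ≤ c.act τ t ↔ (c.f ≤ lk4 (gp (epT τ) t).fb c.f ∧ (lk4 (gp (epT τ) t).fb c.f = c.f → 64 * c.b 1 + c.b 0 ≤ aB (c.b 0) (c.b 1) (d0T τ c.f) 0 (gp (epT τ) t)) ∧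
     (lk4 (gp (epT τ) t).fb c.f = c.f → aB (c.b 0) (c.b 1) (d0T τ c.f) 0 (gp (epT τ) t) = 64 * c.b 1 + c.b 0 → 64 * c.b 3 + c.b 2 ≤ aE (c.b 2) (c.b 3) (toE (c.b 0) (c.b 1) (d0T τ c.f) 0 (d2T τ c.f) 8 (gp (epT τ) t))))) := by
    intro c hc t
    have := hc.b64 0; have := hc.b64 1; have := hc.b64 2; have := hc.b64 3
    exact key_le _ _ _ _ _ _ (by omega) (by omega) (aB_lt _ _ _ _ _ _) (aE_lt _ _ _ _ _ _ _ _ _ he)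
  constructor
  · rintro ⟨f, hf, hok, hg1, b1, h1, b0, h0, ha01, hg2, b3, h3, ha3, b2, h2, ha2, hg3, rfl⟩
    have hc : (Cd.mk f ![b0,b1,b2,b3]).ok τ := ⟨hf, hok, by intro r; fin_cases r <;> assumption⟩
    refine ⟨⟨f, ![b0,b1,b2,b3]⟩, hc, ?_, ?_, rfl⟩
    · rw [ascs_iff]; exact ⟨ha01, ha3, ha2⟩
    · intro t ht
      rw [L _ hc]
      have hm := (mem_TT τ _).2 ⟨t, ht, rfl⟩
      exact ⟨hg1 _ hm, hg2 _ hm, hg3 _ hm⟩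
  · rintro ⟨c, hc, ha, hg, rfl⟩
    obtain ⟨h1, h2, h3⟩ := (ascs_iff τ c).1 ha
    refine ⟨c.f, hc.f16, hc.okf, ?_, c.b 1, hc.b64 _, c.b 0, hc.b64 _, h1, ?_, c.b 3, hc.b64 _, h2, c.b 2, hc.b64 _, h3, ?_, rfl⟩
    · intro g hg'
      obtain ⟨t, ht, rfl⟩ := (mem_TT τ g).1 hg'
      exact ((L c hc t).1 (hg t ht)).1
    · intro g hg'
      obtain ⟨t, ht, rfl⟩ := (mem_TT τ g).1 hg'
      exact ((L c hc t).1 (hg t ht)).2.1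
    · intro g hg'
      obtain ⟨t, ht, rfl⟩ := (mem_TT τ g).1 hg'
      exact ((L c hc t).1 (hg t ht)).2.2
end BR
namespace BR
set_option linter.unusedSimpArgs false
abbrev A := ZMod 2 × ZMod 2 × ZMod 4 × ZMod 4
def dbl : ZMod 2 →+ ZMod 4 where
  toFun := ![0, 2]
  map_zero' := rfl
  map_add' := by decide
def red : ZMod 4 →+ ZMod 2 where
  toFun := ![0, 1, 0, 1]
  map_zero' := rfl
  map_add' := by decide
def om (v : Fin 4 → ZMod 2) : A := (v 0, v 1, dbl (v 2), dbl (v 3))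
def nu (a : A) : Fin 4 → ZMod 2 := ![a.1, a.2.1, red a.2.2.1, red a.2.2.2]
def u : Fin 4 → A := ![(1,0,0,0),(0,1,0,0),(0,0,1,0),(0,0,0,1)]
def M (τ : Tg) (c : Cd) (x y : A) : A := om (fun r => Qf (c.S τ r) (nu x) (nu y)) + (0, 0, (epT τ : ZMod 4) * (x.2.2.2 * y.2.2.2), 0)
def tv : Tg → A | .t8 => (0,0,2,0) | .t1 => (1,0,0,0) | .t4 => (0,0,1,0)
structure Good (m : A → A → A) (t : A) : Prop where
  add_left : ∀ x y z, m (x + y) z = m x z + m y z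
  comm : ∀ x y, m x y = m y x
  assoc : ∀ x y z, m (m x y) z = m x (m y z)
  phi : ∀ x, x + x + m x x = 0 ∨ x + x + m x x = t
  att : ∃ x, x + x + m x x = t
  tne : t ≠ 0
  tt : t + t + m t t = 0
theorem dbl_inj : ∀ a b, dbl a = dbl b → a = b := by decide
theorem red_dbl : ∀ a, red (dbl a) = 0 := by decide
theorem dbl_mul : ∀ a b, dbl a * b = dbl (a * red b) := by decide
theorem two_eq : ∀ a : ZMod 4, a + a = dbl (red a) := by decide
theorem z2 : ∀ a : ZMod 2, a + a = 0 := by decide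
theorem four_eq : ∀ a : ZMod 4, a + a = 0 → ∃ b, a = dbl b := by decide
theorem om_add (v w : Fin 4 → ZMod 2) : om (fun r => v r + w r) = om v + om w := by
  simp [om]
theorem om_inj {v w : Fin 4 → ZMod 2} (h : om v = om w) : v = w := by
  simp only [om, Prod.mk.injEq] at h
  obtain ⟨h0, h1, h2, h3⟩ := h
  funext r; fin_cases r
  exacts [h0, h1, dbl_inj _ _ h2, dbl_inj _ _ h3]
theorem om_surj (a : A) (h : a + a = 0) : ∃ v, a = om v := by
  obtain ⟨a0, a1, a2, a3⟩ := a
  simp only [Prod.mk_add_mk, Prod.mk_eq_zero] at h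
  obtain ⟨_, _, h2, h3⟩ := h
  obtain ⟨b2, rfl⟩ := four_eq _ h2
  obtain ⟨b3, rfl⟩ := four_eq _ h3
  exact ⟨![a0, a1, b2, b3], rfl⟩
theorem nu_add (a b : A) (i : Fin 4) : nu (a + b) i = nu a i + nu b i := by
  fin_cases i <;> simp [nu]
theorem nu_u : ∀ i j : Fin 4, nu (u i) j = if j = i then 1 else 0 := by decide
theorem Qf_add_left (S) (v v' w : Fin 4 → ZMod 2) : Qf S (fun i => v i + v' i) w = Qf S v w + Qf S v' w := by
  simp only [Qf, ← Finset.sum_add_distrib]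
  refine Finset.sum_congr rfl fun _ _ => Finset.sum_congr rfl fun _ _ => by ring
theorem Qf_comm {S : Fin 4 → Fin 4 → ZMod 2} (hS : ∀ i j, S i j = S j i) (v w : Fin 4 → ZMod 2) : Qf S v w = Qf S w v := by
  simp only [Qf]
  rw [Finset.sum_comm]
  refine Finset.sum_congr rfl fun k _ => Finset.sum_congr rfl fun l _ => by rw [hS]; ring
theorem Qf_u (S) (i j : Fin 4) : Qf S (nu (u i)) (nu (u j)) = S i j := by
  simp [Qf, nu_u]
theorem Qf_u_right (S) (v) (k : Fin 4) : Qf S v (nu (u k)) = ∑ i, S i k * v i := by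
  simp [Qf, nu_u]
theorem basis_ind (P : AddSubmonoid A) (h : ∀ i, u i ∈ P) (x : A) : x ∈ P := by
  have : ∀ x : A, x = x.1.val • u 0 + x.2.1.val • u 1 + x.2.2.1.val • u 2 + x.2.2.2.val • u 3 := by decide
  rw [this x]
  exact P.add_mem (P.add_mem (P.add_mem (P.nsmul_mem (h _) _) (P.nsmul_mem (h _) _)) (P.nsmul_mem (h _) _)) (P.nsmul_mem (h _) _)
theorem addext {B : Type*} [AddCommGroup B] {f g : A → B} (hf : ∀ x y, f (x + y) = f x + f y) (hg : ∀ x y, g (x + y) = g x + g y)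
   (h : ∀ i, f (u i) = g (u i)) (x : A) : f x = g x := by
  have := basis_ind (AddMonoidHom.eqLocusM (AddMonoidHom.mk' f hf) (AddMonoidHom.mk' g hg)) h x
  exact this
theorem biext {m m' : A → A → A} (h1 : ∀ x y z, m (x + y) z = m x z + m y z) (h2 : ∀ x y z, m z (x + y) = m z x + m z y)
   (h1' : ∀ x y z, m' (x + y) z = m' x z + m' y z) (h2' : ∀ x y z, m' z (x + y) = m' z x + m' z y)
   (h : ∀ i j, m (u i) (u j) = m' (u i) (u j)) (x y : A) : m x y = m' x y := by
  refine addext (f := fun x => m x y) (g := fun x => m' x y) (fun a b => h1 _ _ _) (fun a b => h1' _ _ _) ?_ x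
  intro i
  exact addext (f := fun y => m (u i) y) (g := fun y => m' (u i) y) (fun a b => h2 _ _ _) (fun a b => h2' _ _ _) (h i) y
theorem S_symm (τ c r i j) : Cd.S τ c r i j = Cd.S τ c r j i := Sm_symm _ _ _ _
theorem M_comm (τ c x y) : M τ c x y = M τ c y x := by
  simp only [M]
  congr 1
  · congr 1; funext r; exact Qf_comm (S_symm τ c r) _ _
  · rw [mul_comm x.2.2.2]
theorem M_add (τ c) (x y z : A) : M τ c (x + y) z = M τ c x z + M τ c y z := by
  have h : nu (x + y) = fun i => nu x i + nu y i := funext (nu_add x y)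
  simp only [M, h, Qf_add_left, om_add, Prod.snd_add, add_mul, mul_add]
  have : ∀ a b : ZMod 4, ((0, 0, a + b, 0) : A) = (0,0,a,0) + (0,0,b,0) := by intros; simp
  rw [this]; abel
theorem M_add' (τ c) (x y z : A) : M τ c z (x + y) = M τ c z x + M τ c z y := by
  rw [M_comm, M_add, M_comm, M_comm τ c y]
theorem M_u (τ c) (i j : Fin 4) : M τ c (u i) (u j) = om (fun r => c.S τ r i j) + (0,0,(epT τ : ZMod 4) * (if i = 3 ∧ j = 3 then 1 else 0),0) := by
  simp only [M, Qf_u]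
  have : ∀ i j : Fin 4, (u i).2.2.2 * (u j).2.2.2 = if i = 3 ∧ j = 3 then 1 else 0 := by decide
  rw [this]
theorem red_ep : ∀ (τ : Tg) (b : Prop) [Decidable b], red ((epT τ : ZMod 4) * if b then 1 else 0) = (epT τ : ZMod 2) * if b then 1 else 0 := by
  intro τ b _; cases τ <;> by_cases h : b <;> simp only [epT, h, if_true, if_false] <;> decide
theorem ep_dbl : ∀ (τ : Tg) (b : ZMod 2), (epT τ : ZMod 4) * dbl b = dbl ((epT τ : ZMod 2) * b) := by
  intro τ; cases τ <;> simp [epT]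
theorem M_uuu (τ c) (i j k : Fin 4) : M τ c (M τ c (u i) (u j)) (u k) = om (fun r => c.L τ r i j k) := by
  have hn : nu (M τ c (u i) (u j)) = ![c.S τ 0 i j, c.S τ 1 i j, (epT τ : ZMod 2) * if i = 3 ∧ j = 3 then 1 else 0, 0] := by
    rw [M_u]
    funext r
    fin_cases r
    · simp [nu, om]
    · simp [nu, om]
    · have := red_ep τ (i = 3 ∧ j = 3)
      simp only [nu, om, Prod.mk_add_mk, map_add, red_dbl, zero_add]
      exact this
    · simp [nu, om, red_dbl]
  have h3 : (M τ c (u i) (u j)).2.2.2 = dbl (c.S τ 3 i j) := by rw [M_u]; simp [om]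
  have hu : ∀ k : Fin 4, red (u k).2.2.2 = if k = 3 then 1 else 0 := by decide
  have : ∀ x y, M τ c x y = om (fun r => Qf (c.S τ r) (nu x) (nu y)) + (0, 0, (epT τ : ZMod 4) * (x.2.2.2 * y.2.2.2), 0) := fun _ _ => rfl
  rw [this (M τ c (u i) (u j)), hn, h3, dbl_mul, hu, ep_dbl]
  have h4 : ∀ a : ZMod 2, ((0,0,dbl a,0) : A) = om (fun r => if r = 2 then a else 0) := by intro a; simp [om]
  rw [h4, ← om_add]
  congr 1
  funext r
  simp only [Qf_u_right, Fin.sum_univ_four, Cd.L]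
  by_cases h1 : r = 2 <;> by_cases h2 : i = 3 ∧ j = 3 <;> by_cases h3 : k = 3 <;> simp [h1, h2, h3] <;> ring
theorem M_assoc_iff (τ c) : (∀ x y z, M τ c (M τ c x y) z = M τ c x (M τ c y z)) ↔ c.Asc τ := by
  constructor
  · intro h r i j k
    have := h (u i) (u j) (u k)
    rw [M_comm τ c (u i) (M τ c (u j) (u k)), M_comm τ c (u j) (u k), M_uuu, M_uuu] at this
    exact congrFun (om_inj this) r
  · intro h x y z
    refine addext (f := fun x => M τ c (M τ c x y) z) (g := fun x => M τ c x (M τ c y z)) (fun a b => by simp only [M_add]) (fun a b => M_add _ _ _ _ _) (fun i => ?_) x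
    refine addext (f := fun y => M τ c (M τ c (u i) y) z) (g := fun y => M τ c (u i) (M τ c y z)) (fun a b => by simp only [M_add, M_add']) (fun a b => by simp only [M_add, M_add']) (fun j => ?_) y
    refine addext (f := fun z => M τ c (M τ c (u i) (u j)) z) (g := fun z => M τ c (u i) (M τ c (u j) z)) (fun a b => by simp only [M_add']) (fun a b => by simp only [M_add']) (fun k => ?_) z
    rw [M_comm τ c (u i) (M τ c (u j) (u k)), M_comm τ c (u j) (u k), M_uuu, M_uuu]
    congr 1; funext r; exact h r i j k
theorem Qf_diag {S : Fin 4 → Fin 4 → ZMod 2} (hS : ∀ i j, S i j = S j i) (v : Fin 4 → ZMod 2) : Qf S v v = ∑ k, S k k * v k := by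
  have h2 : ∀ a : ZMod 2, a * a = a := by decide
  have h3 : (2 : ZMod 2) = 0 := by decide
  simp only [Qf, Fin.sum_univ_four, hS 1 0, hS 2 0, hS 3 0, hS 2 1, hS 3 1, hS 3 2]
  linear_combination (S 0 0) * h2 (v 0) + (S 1 1) * h2 (v 1) + (S 2 2) * h2 (v 2) + (S 3 3) * h2 (v 3) + (S 0 1 * v 0 * v 1 + S 0 2 * v 0 * v 2 + S 0 3 * v 0 * v 3 + S 1 2 * v 1 * v 2 + S 1 3 * v 1 * v 3 + S 2 3 * v 2 * v 3) * h3
theorem Sm_diag (b d : ℕ) (k : Fin 4) : Sm b d k k = bz d k := by simp [Sm]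
def fv (f : ℕ) (x : A) : ZMod 2 := ∑ k : Fin 4, bz f k * nu x k
theorem two_om (x : A) : x + x = om ![0, 0, nu x 2, nu x 3] := by
  obtain ⟨a, b, c, d⟩ := x
  simp [om, nu, z2, two_eq]
theorem bz4 : ∀ k : Fin 4, bz 4 k = if k = 2 then 1 else 0 := by decide
def tvc (τ : Tg) (a : ZMod 2) (x : A) : A := match τ with
  | .t8 => (0,0,dbl a,0)
  | .t1 => (a,0,0,0)
  | .t4 => (0,0,x.2.2.2 * x.2.2.2, 0)
theorem M_phi (τ c) (x : A) : x + x + M τ c x x = tvc τ (fv c.f x) x := by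
  rw [two_om, M, ← add_assoc, ← om_add]
  have h : ∀ r, Qf (c.S τ r) (nu x) (nu x) = ∑ k : Fin 4, bz (ddT τ c.f r) k * nu x k := by
    intro r
    rw [Qf_diag (S_symm τ c r)]
    simp only [Cd.S, Sm_diag]
  simp only [h]
  cases τ
  · simp [om, tvc, ddT, d0T, d2T, bz_zero, bz_xr, bz8, bz4, epT, z2, add_mul, Finset.sum_add_distrib, ← add_assoc, fv]
  · simp [om, tvc, ddT, d0T, d2T, bz_zero, bz_xr, bz8, bz4, epT, z2, add_mul, Finset.sum_add_distrib, ← add_assoc, fv]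
  · simp [om, tvc, ddT, d0T, d2T, bz_zero, bz_xr, bz8, bz4, epT, z2, add_mul, Finset.sum_add_distrib, ← add_assoc, fv]
theorem exists_bit {f : ℕ} (h : f < 16) (h1 : 1 ≤ f) : ∃ k : Fin 4, bz f k = 1 := by
  interval_cases f <;> decide
theorem even_bit {f : ℕ} (h : f < 16) (h1 : f % 2 = 0) : bz f 0 = 0 := by
  interval_cases f <;> first | decide | omega
theorem good_M {τ c} (hc : Cd.ok τ c) (ha : c.Asc τ) : Good (M τ c) (tv τ) where
  add_left := M_add τ c
  comm := M_comm τ c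
  assoc := (M_assoc_iff τ c).2 ha
  phi x := by
    rw [M_phi]
    cases τ
    · generalize fv c.f x = a; revert a; simp only [tvc, tv]; decide
    · generalize fv c.f x = a; revert a; simp only [tvc, tv]; decide
    · simp only [tvc, tv]; generalize x.2.2.2 = a; revert a; decide
  att := by
    simp only [M_phi]
    have hb : okF τ c.f → τ ≠ .t4 → 1 ≤ c.f := by
      cases τ
      · intro h _; exact h
      · intro h _; exact h.1
      · intro _ h; exact absurd rfl h
    have hu : ∀ k : Fin 4, fv c.f (u k) = bz c.f k := by intro k; simp [fv, nu_u]
    cases τ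
    · obtain ⟨k, hk⟩ := exists_bit hc.f16 (hb hc.okf (by simp))
      exact ⟨u k, by rw [hu, hk]; rfl⟩
    · obtain ⟨k, hk⟩ := exists_bit hc.f16 (hb hc.okf (by simp))
      exact ⟨u k, by rw [hu, hk]; rfl⟩
    · exact ⟨u 3, rfl⟩
  tne := by cases τ <;> decide
  tt := by
    rw [M_phi]
    cases τ
    · have : nu (tv .t8) = 0 := by decide
      simp [fv, this, tvc]
    · have : nu (tv .t1) = nu (u 0) := by decide
      have := even_bit hc.f16 hc.okf.2
      simp [fv, nu_u, tvc, *]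
    · rfl
end BR
namespace BR
theorem enc_ex6 (g : Fin 6 → ZMod 2) : ∃ b < 64, ∀ n : Fin 6, bz b n = g n := by
  refine ⟨enc6 (g 0).val (g 1).val (g 2).val (g 3).val (g 4).val (g 5).val, enc6_lt (vle _) (vle _) (vle _) (vle _) (vle _) (vle _), ?_⟩
  have := bz_enc6 (vle (g 0)) (vle (g 1)) (vle (g 2)) (vle (g 3)) (vle (g 4)) (vle (g 5))
  simp only [vc] at this
  obtain ⟨h0, h1, h2, h3, h4, h5⟩ := this
  intro n; fin_cases n
  exacts [h0, h1, h2, h3, h4, h5]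
theorem enc_ex4 (g : Fin 4 → ZMod 2) : ∃ b < 16, ∀ n : Fin 4, bz b n = g n := by
  refine ⟨enc4 (g 0).val (g 1).val (g 2).val (g 3).val, enc4_lt (vle _) (vle _) (vle _) (vle _), ?_⟩
  have := bz_enc4 (vle (g 0)) (vle (g 1)) (vle (g 2)) (vle (g 3))
  simp only [vc] at this
  obtain ⟨h0, h1, h2, h3⟩ := this
  intro n; fin_cases n
  exacts [h0, h1, h2, h3]
theorem Sm_off (b d : ℕ) (n : Fin 6) : Sm b d (pi n) (pj n) = bz b n := by
  fin_cases n <;> rfl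
theorem pair_cases {P : Fin 4 → Fin 4 → Prop} (hs : ∀ i j, P i j → P j i) (hd : ∀ i, P i i) (ho : ∀ n, P (pi n) (pj n)) (i j) : P i j := by
  have : ∀ i j : Fin 4, i = j ∨ (∃ n, i = pi n ∧ j = pj n) ∨ (∃ n, j = pi n ∧ i = pj n) := by decide
  rcases this i j with rfl | ⟨n, rfl, rfl⟩ | ⟨n, rfl, rfl⟩
  · exact hd _
  · exact ho _
  · exact hs _ _ (ho _)
theorem fv_u (f : ℕ) (k : Fin 4) : fv f (u k) = bz f k := by simp [fv, nu_u]
theorem pne : ∀ n, ¬ (pi n = 3 ∧ pj n = 3) := by decide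
theorem M_off (τ c n) : M τ c (u (pi n)) (u (pj n)) = om (fun r => bz (c.b r) n) := by
  rw [M_u]
  simp only [Cd.S, Sm_off, if_neg (pne n), mul_zero]
  exact add_zero _
theorem F2core (τ : Tg) (m : A → A → A) (hl : ∀ x y z, m (x + y) z = m x z + m y z) (hcm : ∀ x y, m x y = m y x)
   (f : ℕ) (hf : f < 16) (hok : okF τ f) (hoff : ∀ n, m (u (pi n)) (u (pj n)) + m (u (pi n)) (u (pj n)) = 0)
   (hd : ∀ i, u i + u i + m (u i) (u i) = tvc τ (bz f i) (u i)) : ∃ c : Cd, c.ok τ ∧ ∀ x y, m x y = M τ c x y := by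
  choose v hv using fun n => om_surj _ (hoff n)
  choose b hb hb' using fun r : Fin 4 => enc_ex6 (fun n => v n r)
  refine ⟨⟨f, b⟩, ⟨hf, hok, hb⟩, ?_⟩
  apply biext hl (fun x y z => by rw [hcm, hl, hcm, hcm y]) (M_add _ _) (M_add' _ _)
  apply pair_cases
  · intro i j h; rw [hcm, h, M_comm]
  · intro i
    have := (hd i).trans ((fv_u f i) ▸ (M_phi τ ⟨f, b⟩ (u i)).symm)
    exact add_left_cancel this
  · intro n
    rw [M_off, hv]
    congr 1; funext r; exact (hb' r n).symm
theorem Good.add_right {m t} (h : Good m t) (x y z : A) : m z (x + y) = m z x + m z y := by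
  rw [h.comm, h.add_left, h.comm, h.comm y]
theorem Good.zero_left {m t} (h : Good m t) (z : A) : m 0 z = 0 := by
  have := h.add_left 0 0 z
  simpa using this
theorem Good.zero_right {m t} (h : Good m t) (z : A) : m z 0 = 0 := by rw [h.comm, h.zero_left]
theorem Good.phi_add {m t} (h : Good m t) (x y : A) : (x + y) + (x + y) + m (x + y) (x + y) = (x + x + m x x) + (y + y + m y y) + (m x y + m x y) := by
  rw [h.add_left, h.add_right, h.add_right, h.comm y x]; abel
theorem four (x : A) : (x + x) + (x + x) = 0 := by revert x; decide
theorem Good.four {m t} (h : Good m t) (x y : A) : (m x y + m x y) + (m x y + m x y) = 0 := BR.four _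
theorem Good.nz {m t} (h : Good m t) (hc : ∀ x y, m x y + m x y ≠ t) : ∃ i, u i + u i + m (u i) (u i) ≠ 0 := by
  by_contra! hh
  let P : AddSubmonoid A :=
    { carrier := {x | x + x + m x x = 0}
      zero_mem' := by simp [h.zero_left]
      add_mem' := by
        intro x y hx hy
        simp only [Set.mem_setOf_eq] at *
        have h1 := h.phi_add x y
        rw [hx, hy, zero_add, zero_add] at h1
        rcases h.phi (x + y) with h2 | h2
        · exact h2
        · exact absurd (h1.symm.trans h2) (hc x y) }
  obtain ⟨x, hx⟩ := h.att
  have : x ∈ P := basis_ind P hh x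
  exact h.tne (hx.symm.trans this)
theorem uu0 : u 0 + u 0 = 0 := by decide
theorem uu1 : u 1 + u 1 = 0 := by decide
theorem Good.off {m t} (h : Good m t) (h23 : m (u 2) (u 3) + m (u 2) (u 3) = 0) (n) : m (u (pi n)) (u (pj n)) + m (u (pi n)) (u (pj n)) = 0 := by
  have h0 : ∀ y, m (u 0) y + m (u 0) y = 0 := by intro y; rw [← h.add_left, uu0, h.zero_left]
  have h1 : ∀ y, m (u 1) y + m (u 1) y = 0 := by intro y; rw [← h.add_left, uu1, h.zero_left]
  fin_cases n
  exacts [h0 _, h0 _, h0 _, h1 _, h1 _, h23]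
theorem F2_81 {τ m} (h : Good m (tv τ)) (hτ : ∀ i, tvc τ 1 (u i) = tv τ ∧ tvc τ 0 (u i) = 0) (hc : ∀ x y, m x y + m x y ≠ tv τ)
   (h23 : m (u 2) (u 3) + m (u 2) (u 3) = 0) (hok : ∀ f, 1 ≤ f → (bz f 0 = 1 → u 0 + u 0 + m (u 0) (u 0) = tv τ) → okF τ f) :
   ∃ c : Cd, c.ok τ ∧ ∀ x y, m x y = M τ c x y := by
  classical
  obtain ⟨f, hf, hb⟩ := enc_ex4 (fun i => if u i + u i + m (u i) (u i) = tv τ then 1 else 0)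
  refine F2core τ m h.add_left h.comm f hf (hok f ?_ ?_) (h.off h23) ?_
  · obtain ⟨i, hi⟩ := h.nz hc
    have := hb i
    rw [if_pos ((h.phi (u i)).resolve_left hi)] at this
    rcases Nat.eq_zero_or_pos f with rfl | h'
    · rw [bz_zero] at this; exact absurd this (by decide)
    · exact h'
  · intro h0
    have := hb 0
    rw [Fin.val_zero, h0] at this
    by_contra hn
    rw [if_neg hn] at this
    exact absurd this (by decide)
  · intro i
    rw [hb i]
    by_cases hi : u i + u i + m (u i) (u i) = tv τ
    · rw [if_pos hi, hi, (hτ i).1]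
    · rw [if_neg hi, (hτ i).2]; exact (h.phi _).resolve_right hi
theorem F2_8 {m} (h : Good m (tv .t8)) : ∃ c : Cd, c.ok .t8 ∧ ∀ x y, m x y = M .t8 c x y := by
  have h2t : tv .t8 + tv .t8 = 0 := by decide
  have hp2 : ∀ x, (x + x + m x x) + (x + x + m x x) = 0 := by
    intro x
    rcases h.phi x with h1 | h1 <;> rw [h1]
    · rfl
    · exact h2t
  have h23 : m (u 2) (u 3) + m (u 2) (u 3) = 0 := by
    have hs : m (u 2) (u 3) + m (u 2) (u 3) = 0 ∨ m (u 2) (u 3) + m (u 2) (u 3) = tv .t8 := by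
      have h1 := h.phi_add (u 2) (u 3)
      have key : ∀ a b c d : A, (a = 0 ∨ a = tv .t8) → (b = 0 ∨ b = tv .t8) → (c = 0 ∨ c = tv .t8) → a = b + c + d → d = 0 ∨ d = tv .t8 := by
        rintro a b c d (rfl | rfl) (rfl | rfl) (rfl | rfl) <;> revert d <;> decide
      exact key _ _ _ _ (h.phi _) (h.phi _) (h.phi _) h1
    rcases hs with hs | hs
    · exact hs
    · exfalso
      have e1 : m (tv .t8) (u 3) = tv .t8 := by
        have : tv .t8 = u 2 + u 2 := by decide
        conv_lhs => rw [this]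
        rw [h.add_left, hs]
      have e2 : m (tv .t8) (u 3) = 0 := by
        rw [← hs, h.add_left, h.assoc, ← h.add_right]
        have h4 : m (u 3) (u 3) + m (u 3) (u 3) = 0 := by
          have := hp2 (u 3)
          have h5 := BR.four (u 3)
          calc m (u 3) (u 3) + m (u 3) (u 3) = ((u 3 + u 3 + m (u 3) (u 3)) + (u 3 + u 3 + m (u 3) (u 3))) - ((u 3 + u 3) + (u 3 + u 3)) := by abel
            _ = 0 := by rw [this, h5, sub_zero]
        rw [h4, h.zero_right]
      exact h.tne (e1.symm.trans e2)
  have hall : ∀ x y, m x y + m x y = 0 := by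
    refine biext (m := fun x y => m x y + m x y) (m' := fun _ _ => 0) ?_ ?_ ?_ ?_ ?_
    · intro x y z; simp only [h.add_left]; abel
    · intro x y z; simp only [h.add_right]; abel
    · intros; simp
    · intros; simp
    · apply pair_cases
      · intro i j h'; simp only [h.comm (u j)]; exact h'
      · intro i
        have := hp2 (u i)
        have h5 := BR.four (u i)
        calc m (u i) (u i) + m (u i) (u i) = ((u i + u i + m (u i) (u i)) + (u i + u i + m (u i) (u i))) - ((u i + u i) + (u i + u i)) := by abel
            _ = 0 := by rw [this, h5, sub_zero]
      · intro n; exact h.off h23 n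
  refine F2_81 h ?_ ?_ h23 ?_
  · decide
  · intro x y; rw [hall]; exact h.tne.symm
  · intro f hf _; exact hf
theorem F2_1 {m} (h : Good m (tv .t1)) : ∃ c : Cd, c.ok .t1 ∧ ∀ x y, m x y = M .t1 c x y := by
  have hc : ∀ x : A, x + x ≠ tv .t1 := by decide
  refine F2_81 h ?_ (fun x y => hc _) ?_ ?_
  · decide
  · have h1 := h.phi_add (u 2) (u 3)
    have key : ∀ a b c d : A, (a = 0 ∨ a = tv .t1) → (b = 0 ∨ b = tv .t1) → (c = 0 ∨ c = tv .t1) → a = b + c + d → d ≠ tv .t1 → d = 0 := by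
      rintro a b c d (rfl | rfl) (rfl | rfl) (rfl | rfl) <;> revert d <;> decide
    exact key _ _ _ _ (h.phi _) (h.phi _) (h.phi _) h1 (hc _)
  · intro f hf h0
    refine ⟨hf, ?_⟩
    by_contra hh
    have h1 : bz f 0 = 1 := by
      rw [bz_eq, Nat.testBit_zero]; simp; omega
    have h2 := h0 h1
    have h3 : u 0 = tv .t1 := by decide
    rw [h3, h.tt] at h2
    exact h.tne h2.symm
theorem F2_4 {m} (h : Good m (tv .t4)) : ∃ c : Cd, c.ok .t4 ∧ ∀ x y, m x y = M .t4 c x y := by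
  have ht : u 2 = tv .t4 := by decide
  have hc : ∀ x y, m x y + m x y ≠ tv .t4 := by
    intro x y hh
    have := h.four x y
    rw [hh] at this
    revert this; decide
  have p0 : u 0 + u 0 + m (u 0) (u 0) = 0 := by
    refine (h.phi _).resolve_right ?_
    intro hh
    rw [uu0, zero_add] at hh
    have : m (u 0) (u 0) + m (u 0) (u 0) = 0 := by rw [← h.add_left, uu0, h.zero_left]
    rw [hh] at this
    revert this; decide
  have p1 : u 1 + u 1 + m (u 1) (u 1) = 0 := by
    refine (h.phi _).resolve_right ?_
    intro hh
    rw [uu1, zero_add] at hh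
    have : m (u 1) (u 1) + m (u 1) (u 1) = 0 := by rw [← h.add_left, uu1, h.zero_left]
    rw [hh] at this
    revert this; decide
  have p2 : u 2 + u 2 + m (u 2) (u 2) = 0 := by rw [ht]; exact h.tt
  have p3 : u 3 + u 3 + m (u 3) (u 3) = tv .t4 := by
    obtain ⟨i, hi⟩ := h.nz hc
    refine (h.phi _).resolve_left ?_
    intro p3
    fin_cases i
    exacts [hi p0, hi p1, hi p2, hi p3]
  refine F2core .t4 m h.add_left h.comm 0 (by omega) rfl (h.off ?_) ?_
  · have h1 := h.phi_add (u 2) (u 3)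
    rw [p2, p3, zero_add] at h1
    have key : ∀ a d : A, (a = 0 ∨ a = tv .t4) → a = tv .t4 + d → d + d + (d + d) = 0 → (∃ e, d = e + e) → d = 0 := by
      rintro a d (rfl | rfl) <;> revert d <;> decide
    exact key _ _ (h.phi _) h1 (BR.four _) ⟨_, rfl⟩
  · intro i
    fin_cases i
    exacts [p0, p1, p2, p3]
theorem F2 {τ m} (h : Good m (tv τ)) : ∃ c : Cd, c.ok τ ∧ c.Asc τ ∧ m = M τ c := by
  obtain ⟨c, hc, hm⟩ : ∃ c : Cd, c.ok τ ∧ ∀ x y, m x y = M τ c x y := by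
    cases τ
    exacts [F2_8 h, F2_1 h, F2_4 h]
  have hm : m = M τ c := by funext x y; exact hm x y
  refine ⟨c, hc, ?_, hm⟩
  rw [← M_assoc_iff, ← hm]; exact h.assoc
end BR
namespace BR
structure Par (g : A → A) (t : Th) : Prop where
  g0 : g (u 0) = om ![t.p, t.q, t.x, t.y]
  g1 : g (u 1) = om ![t.r, t.s, t.z, t.w]
  g2 : nu (g (u 2)) = ![t.k1, t.k2, t.P, t.Q]
  g3 : nu (g (u 3)) = ![t.l1, t.l2, t.R, t.S]
def Nm (t : Th) : Matrix (Fin 4) (Fin 4) (ZMod 2) := !![t.p, t.q, 0, 0; t.r, t.s, 0, 0; t.k1, t.k2, t.P, t.Q; t.l1, t.l2, t.R, t.S]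
def Wm (t : Th) : Matrix (Fin 4) (Fin 4) (ZMod 2) := ![![t.p, t.q, t.x, t.y], ![t.r, t.s, t.z, t.w], ![0, 0, t.P, t.Q], ![0, 0, t.R, t.S]]
theorem nu_om (v : Fin 4 → ZMod 2) : nu (om v) = ![v 0, v 1, 0, 0] := by
  funext r; fin_cases r <;> simp [nu, om, red_dbl]
theorem nu_g {g : A → A} {t : Th} (ha : ∀ x y, g (x + y) = g x + g y) (hp : Par g t) (x : A) (j : Fin 4) : nu (g x) j = ∑ i, nu x i * Nm t i j := by
  refine addext (f := fun x => nu (g x) j) (g := fun x => ∑ i, nu x i * Nm t i j) ?_ ?_ ?_ x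
  · intro x y; simp only [ha, nu_add]
  · intro x y; simp only [nu_add, add_mul, Finset.sum_add_distrib]
  · intro i
    simp only [nu_u, ite_mul, one_mul, zero_mul, Finset.sum_ite_eq', Finset.sum_ite_eq, Finset.mem_univ, if_true]
    fin_cases i
    · show nu (g (u 0)) j = _
      rw [hp.g0, nu_om]; rfl
    · show nu (g (u 1)) j = _
      rw [hp.g1, nu_om]; rfl
    · show nu (g (u 2)) j = _
      rw [hp.g2]; rfl
    · show nu (g (u 3)) j = _
      rw [hp.g3]; rfl
theorem om_dec (v : Fin 4 → ZMod 2) : om v = (v 0).val • u 0 + (v 1).val • u 1 + (v 2).val • (u 2 + u 2) + (v 3).val • (u 3 + u 3) := by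
  have : ∀ a b c d : ZMod 2, om ![a,b,c,d] = a.val • u 0 + b.val • u 1 + c.val • (u 2 + u 2) + d.val • (u 3 + u 3) := by decide
  rw [← this]; rfl
theorem val_om (a : ZMod 2) (v : Fin 4 → ZMod 2) : a.val • om v = om (fun i => a * v i) := by
  revert a
  have : ∀ a : ZMod 2, a = 0 ∨ a = 1 := by decide
  intro a
  rcases this a with rfl | rfl
  · simp [om]; rfl
  · simp [om, ZMod.val_one]
theorem g_om (g : A →+ A) {t : Th} (hp : Par g t) (v : Fin 4 → ZMod 2) : g (om v) = om (fun j => ∑ i, v i * Wm t i j) := by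
  have h2 : g (u 2 + u 2) = om ![0, 0, t.P, t.Q] := by
    rw [map_add, two_om, hp.g2]; rfl
  have h3 : g (u 3 + u 3) = om ![0, 0, t.R, t.S] := by
    rw [map_add, two_om, hp.g3]; rfl
  rw [om_dec, map_add, map_add, map_add, map_nsmul, map_nsmul, map_nsmul, map_nsmul, h2, h3, hp.g0, hp.g1]
  simp only [val_om, ← om_add, Fin.sum_univ_four]
  congr 1
theorem par_ex (g : A →+ A) : ∃ t, Par g t := by
  obtain ⟨v, hv⟩ := om_surj (g (u 0)) (by rw [← map_add, uu0, map_zero])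
  obtain ⟨w, hw⟩ := om_surj (g (u 1)) (by rw [← map_add, uu1, map_zero])
  refine ⟨⟨v 0, v 1, w 0, w 1, nu (g (u 2)) 2, nu (g (u 2)) 3, nu (g (u 3)) 2, nu (g (u 3)) 3, nu (g (u 2)) 0, nu (g (u 2)) 1, nu (g (u 3)) 0, nu (g (u 3)) 1, v 2, v 3, w 2, w 3⟩, ?_, ?_, ?_, ?_⟩
  · rw [hv]; rfl
  · rw [hw]; rfl
  · funext j; fin_cases j <;> rfl
  · funext j; fin_cases j <;> rfl
def Det (t : Th) : Prop := t.p * t.s + t.q * t.r = 1 ∧ t.P * t.S + t.Q * t.R = 1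
theorem al_N {t : Th} (h : Det t) : (Matrix.of (alz t)) * Nm t = 1 := by
  obtain ⟨h1, h2⟩ := h
  have h3 : (2 : ZMod 2) = 0 := by decide
  funext i j
  rw [Matrix.mul_apply, Fin.sum_univ_four]
  fin_cases i <;> fin_cases j <;> simp [alz, Nm, Matrix.one_apply]
  · linear_combination h1
  · linear_combination t.q * t.s * h3
  · linear_combination t.r * t.p * h3
  · linear_combination h1
  · linear_combination (t.S * t.k1 + t.Q * t.l1) * h1 + ((t.S * t.k2 + t.Q * t.l2) * t.r * t.p + (t.S * t.k1 + t.Q * t.l1)) * h3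
  · linear_combination (t.S * t.k2 + t.Q * t.l2) * h1 + ((t.S * t.k1 + t.Q * t.l1) * t.q * t.s + (t.S * t.k2 + t.Q * t.l2)) * h3
  · linear_combination h2
  · linear_combination t.S * t.Q * h3
  · linear_combination (t.R * t.k1 + t.P * t.l1) * h1 + ((t.R * t.k2 + t.P * t.l2) * t.r * t.p + (t.R * t.k1 + t.P * t.l1)) * h3
  · linear_combination (t.R * t.k2 + t.P * t.l2) * h1 + ((t.R * t.k1 + t.P * t.l1) * t.q * t.s + (t.R * t.k2 + t.P * t.l2)) * h3
  · linear_combination t.R * t.P * h3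
  · linear_combination h2
theorem N_al {t : Th} (h : Det t) : Nm t * (Matrix.of (alz t)) = 1 := mul_eq_one_comm.1 (al_N h)
theorem inv_N (g : A ≃+ A) {t : Th} (hp : Par g t) : (Matrix.of fun i => nu (g.symm (u i))) * Nm t = 1 := by
  funext i j
  have := nu_g (map_add g) hp (g.symm (u i)) j
  rw [g.apply_symm_apply, nu_u] at this
  rw [Matrix.mul_apply, Matrix.one_apply]
  simp only [Matrix.of_apply]
  rw [← this]; simp only [eq_comm]
theorem det_N (t : Th) : (Nm t).det = (t.p * t.s - t.q * t.r) * (t.P * t.S - t.Q * t.R) := by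
  simp [Nm, Matrix.det_succ_row_zero, Fin.sum_univ_succ, Fin.succAbove]
  have h3 : (2 : ZMod 2) = 0 := by decide
  linear_combination (t.p * t.s * t.Q * t.R + t.P * t.S * t.q * t.r) * h3
theorem par_det (g : A ≃+ A) {t : Th} (hp : Par g t) : Det t := by
  have h := congrArg Matrix.det (inv_N g hp)
  rw [Matrix.det_mul, det_N, Matrix.det_one] at h
  have key : ∀ a b c d e : ZMod 2, e * ((a - b) * (c - d)) = 1 → a + b = 1 ∧ c + d = 1 := by decide
  exact key _ _ _ _ _ h
theorem inv_al (g : A ≃+ A) {t : Th} (hp : Par g t) (i : Fin 4) : nu (g.symm (u i)) = alz t i := by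
  have h1 := inv_N g hp
  have h2 := N_al (par_det g hp)
  have h3 : (Matrix.of fun i => nu (g.symm (u i))) = Matrix.of (alz t) := by
    rw [← mul_one (Matrix.of fun i => nu (g.symm (u i))), ← h2, ← Matrix.mul_assoc, h1, one_mul]
  exact congrFun h3 i
theorem F4 {τ : Tg} (g : A ≃+ A) (hgt : g (tv τ) = tv τ) : ∃ t, Par g t ∧ okT τ t := by
  obtain ⟨t, hp⟩ := par_ex g.toAddMonoidHom
  replace hp : Par g t := hp
  refine ⟨t, hp, ?_⟩
  obtain ⟨hd1, hd2⟩ := par_det g hp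
  cases τ
  · have h1 : tv .t8 = om ![0,0,1,0] := by decide
    rw [h1] at hgt
    have := om_inj ((g_om g.toAddMonoidHom hp ![0,0,1,0]).symm.trans hgt)
    have e2 := congrFun this 2
    have e3 := congrFun this 3
    simp [Fin.sum_univ_four, Wm] at e2 e3
    refine ⟨hd1, e2, e3, ?_⟩
    rw [e2, e3] at hd2; simpa using hd2
  · have h1 : tv .t1 = u 0 := by decide
    have h2 : u 0 = om ![1,0,0,0] := by decide
    rw [h1, hp.g0, h2] at hgt
    have := om_inj hgt
    have e0 := congrFun this 0
    have e1 := congrFun this 1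
    have e2 := congrFun this 2
    have e3 := congrFun this 3
    simp at e0 e1 e2 e3
    refine ⟨⟨e0, e1, ?_⟩, hd2, e2, e3⟩
    rw [e0, e1] at hd1; simpa using hd1
  · have h1 : tv .t4 = u 2 := by decide
    rw [h1] at hgt
    have := hp.g2
    rw [hgt] at this
    have e0 := congrFun this 0
    have e1 := congrFun this 1
    have e2 := congrFun this 2
    have e3 := congrFun this 3
    simp [nu_u] at e0 e1 e2 e3
    refine ⟨hd1, ⟨e2.symm, e3.symm, ?_⟩, e0.symm, e1.symm⟩
    rw [← e2, ← e3] at hd2; simpa using hd2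
theorem ok_det {τ t} (h : okT τ t) : Det t := by
  cases τ
  · obtain ⟨h1, h2, h3, h4⟩ := h
    exact ⟨h1, by rw [h2, h3, h4]; simp⟩
  · obtain ⟨⟨h2, h3, h4⟩, h1, _⟩ := h
    exact ⟨by rw [h2, h3, h4]; simp, h1⟩
  · obtain ⟨h1, ⟨h2, h3, h4⟩, _⟩ := h
    exact ⟨h1, by rw [h2, h3, h4]; simp⟩
def lf (n : ℕ) (w : A) (h : n • w = 0) : ZMod n →+ A := ZMod.lift n ⟨zmultiplesHom A w, by simpa using h⟩
theorem lf_one (n : ℕ) (w : A) (h : n • w = 0) : lf n w h 1 = w := by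
  have := ZMod.lift_coe n (⟨zmultiplesHom A w, by simpa using h⟩ : {f : ℤ →+ A // f n = 0}) 1
  simpa [lf] using this
def inc : ZMod 2 → ZMod 4 := ![0, 1]
theorem red_inc : ∀ a, red (inc a) = a := by decide
theorem hom_ex (w0 w1 w2 w3 : A) (h0 : w0 + w0 = 0) (h1 : w1 + w1 = 0) : ∃ g : A →+ A, g (u 0) = w0 ∧ g (u 1) = w1 ∧ g (u 2) = w2 ∧ g (u 3) = w3 := by
  have h4 : ∀ w : A, 4 • w = 0 := by decide
  refine ⟨AddMonoidHom.coprod (lf 2 w0 (by rw [two_nsmul, h0])) (AddMonoidHom.coprod (lf 2 w1 (by rw [two_nsmul, h1])) (AddMonoidHom.coprod (lf 4 w2 (h4 _)) (lf 4 w3 (h4 _)))), ?_, ?_, ?_, ?_⟩ <;>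
  simp [u, AddMonoidHom.coprod_apply, lf_one]
theorem par_inj (g : A →+ A) {t : Th} (hp : Par g t) (hd : Det t) : Function.Injective g := by
  rw [injective_iff_map_eq_zero]
  intro x hx
  have n0 : Matrix.vecMul (nu x) (Nm t) = 0 := by
    funext j
    have := nu_g (map_add g) hp x j
    rw [hx] at this
    simp only [Matrix.vecMul, dotProduct, Pi.zero_apply]
    rw [← this]; exact (by decide : ∀ j, nu 0 j = 0) j
  have n1 : nu x = 0 := by
    have := congrArg (fun v => Matrix.vecMul v (Matrix.of (alz t))) n0
    simpa [Matrix.vecMul_vecMul, N_al hd] using this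
  have hxx : x + x = 0 := by rw [two_om, n1]; rfl
  obtain ⟨v, rfl⟩ := om_surj x hxx
  rw [nu_om] at n1
  have v0 : v 0 = 0 := congrFun n1 0
  have v1 : v 1 = 0 := congrFun n1 1
  rw [g_om g hp] at hx
  have hx' := om_inj (hx.trans (show (0 : A) = om (fun _ => 0) by decide))
  have e2 := congrFun hx' 2
  have e3 := congrFun hx' 3
  simp [Fin.sum_univ_four, Wm, v0, v1] at e2 e3
  have key : ∀ a b P Q R S : ZMod 2, P * S + Q * R = 1 → a * P + b * R = 0 → a * Q + b * S = 0 → a = 0 ∧ b = 0 := by decide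
  obtain ⟨v2, v3⟩ := key _ _ _ _ _ _ hd.2 e2 e3
  simp [om, v0, v1, v2, v3]
theorem F3 {τ : Tg} {t : Th} (ht : okT τ t) : ∃ g : A ≃+ A, Par g t ∧ g (tv τ) = tv τ := by
  have hd := ok_det ht
  have hoo : ∀ v, om v + om v = 0 := by intro v; rw [two_om, nu_om]; rfl
  obtain ⟨g, h0, h1, h2, h3⟩ := hom_ex (om ![t.p, t.q, t.x, t.y]) (om ![t.r, t.s, t.z, t.w]) (t.k1, t.k2, inc t.P, inc t.Q) (t.l1, t.l2, inc t.R, inc t.S) (hoo _) (hoo _)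
  have hp : Par g t := by
    refine ⟨h0, h1, ?_, ?_⟩
    · rw [h2]; simp [nu, red_inc]
    · rw [h3]; simp [nu, red_inc]
  have hinj := par_inj g hp hd
  refine ⟨AddEquiv.ofBijective g (Finite.injective_iff_bijective.1 hinj), hp, ?_⟩
  show g (tv τ) = tv τ
  cases τ
  · have h1 : tv .t8 = om ![0,0,1,0] := by decide
    obtain ⟨_, h2, h3, h4⟩ := ht
    rw [h1, g_om g hp]
    congr 1
    funext j; fin_cases j <;> simp [Fin.sum_univ_four, Wm, h2, h3]
  · have h1 : tv .t1 = u 0 := by decide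
    obtain ⟨⟨h2, h3, h4⟩, _, h5, h6⟩ := ht
    rw [h1, hp.g0, h2, h3, h5, h6]; decide
  · have h1 : tv .t4 = u 2 := by decide
    obtain ⟨_, ⟨h3, h4, _⟩, h5, h6⟩ := ht
    rw [h1, h2, h3, h4, h5, h6]; decide
end BR
namespace BR
theorem ex4 (g : A ≃+ A) (hgt : g (tv .t4) = tv .t4) {t : Th} (hp : Par g t) (hok : okT .t4 t) (n : Fin 6) :
    (g.symm (u (pi n))).2.2.2 * (g.symm (u (pj n))).2.2.2 = dbl (exz t n) := by
  obtain ⟨_, ⟨hP, hQ, hS⟩, _⟩ := hok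
  have a2 : (g.symm (u 2)).2.2.2 = 0 := by
    have h1 : tv .t4 = u 2 := by decide
    rw [h1] at hgt
    rw [← hgt, g.symm_apply_apply]; rfl
  have a3 : red (g.symm (u 3)).2.2.2 = 1 := by
    have := congrFun (inv_al g hp 3) 3
    simpa [nu, alz, hP] using this
  have key : ∀ i : Fin 4, u i + u i = 0 → (g.symm (u i)).2.2.2 = dbl (alz t i 0 * t.y + alz t i 1 * t.w) := by
    intro i hi
    have hn := inv_al g hp i
    have h0 : g.symm (u i) + g.symm (u i) = 0 := by rw [← map_add, hi, map_zero]
    obtain ⟨v, hv⟩ := om_surj _ h0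
    obtain ⟨w, hw⟩ := om_surj _ hi
    have h1 := g_om g.toAddMonoidHom hp v
    have h2 : g (om v) = u i := by rw [← hv, g.apply_symm_apply]
    have h3 := om_inj ((h1.symm.trans h2).trans hw)
    have h4 := congrFun h3 3
    have hw3 : w 3 = 0 := by
      have : (u i).2.2.2 = dbl (w 3) := by rw [hw]; rfl
      have h5 : ∀ (i : Fin 4), u i + u i = 0 → (u i).2.2.2 = 0 := by decide
      rw [h5 i hi] at this
      exact (dbl_inj _ _ (this.symm.trans (by decide : (0 : ZMod 4) = dbl 0)))
    rw [hw3] at h4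
    simp [Fin.sum_univ_four, Wm, hQ, hS] at h4
    have hv0 : v 0 = alz t i 0 := by rw [← hn, hv]; rfl
    have hv1 : v 1 = alz t i 1 := by rw [← hn, hv]; rfl
    rw [hv]
    show dbl (v 3) = _
    rw [← hv0, ← hv1]
    congr 1
    have : ∀ a b : ZMod 2, a + b = 0 → b = a := by decide
    exact this _ _ h4
  have a0 := key 0 uu0
  have a1 := key 1 uu1
  have p0 : alz t 0 0 = t.s ∧ alz t 0 1 = t.q ∧ alz t 1 0 = t.r ∧ alz t 1 1 = t.p := ⟨rfl, rfl, rfl, rfl⟩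
  rw [p0.1, p0.2.1] at a0
  rw [p0.2.2.1, p0.2.2.2] at a1
  have dd : ∀ a b, dbl a * dbl b = 0 := by decide
  have hpi : ∀ n : Fin 6, (pi n, pj n) = (![(0,1),(0,2),(0,3),(1,2),(1,3),(2,3)] : Fin 6 → Fin 4 × Fin 4) n := by decide
  have hq := hpi n
  fin_cases n <;> (simp only [Prod.ext_iff] at hq; rw [hq.1, hq.2]; simp [exz, a0, a1, a2, dd])
  · rw [← map_add, ← map_add, dd]
  · rw [← map_add, dbl_mul, a3, mul_one]
  · rw [← map_add, dbl_mul, a3, mul_one]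
theorem g_ex {τ : Tg} (g : A ≃+ A) (hgt : g (tv τ) = tv τ) {t : Th} (hp : Par g t) (hok : okT τ t) (n : Fin 6) :
    g (0, 0, (epT τ : ZMod 4) * ((g.symm (u (pi n))).2.2.2 * (g.symm (u (pj n))).2.2.2), 0) =
     om ![0, 0, t.P * ((epT τ : ZMod 2) * exz t n), t.Q * ((epT τ : ZMod 2) * exz t n)] := by
  cases τ
  · simp only [epT, Nat.cast_zero, zero_mul, mul_zero]
    exact map_zero g
  · simp only [epT, Nat.cast_zero, zero_mul, mul_zero]
    exact map_zero g
  · rw [ex4 g hgt hp hok, ep_dbl]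
    have : ∀ a : ZMod 2, ((0, 0, dbl a, 0) : A) = om ![0, 0, a, 0] := by decide
    rw [this]
    refine (g_om g.toAddMonoidHom hp _).trans ?_
    congr 1
    funext j; fin_cases j <;> simp [Fin.sum_univ_four, Wm, mul_comm]
theorem K {τ : Tg} {c c' : Cd} (hc : c.ok τ) (hc' : c'.ok τ) (g : A ≃+ A) (hg : ∀ x y, g (M τ c x y) = M τ c' (g x) (g y))
    (hgt : g (tv τ) = tv τ) {t : Th} (hp : Par g t) (hok : okT τ t) : c'.key = c.act τ t := by
  have hM : ∀ n : Fin 6, (fun r => bz (c'.b r) n) = fun r => (∑ i, Qf (c.S τ i) (alz t (pi n)) (alz t (pj n)) * Wm t i r) +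
      (![0, 0, t.P * ((epT τ : ZMod 2) * exz t n), t.Q * ((epT τ : ZMod 2) * exz t n)] : Fin 4 → ZMod 2) r := by
    intro n
    apply om_inj
    rw [om_add, ← g_ex g hgt hp hok, ← M_off τ]
    have h1 := hg (g.symm (u (pi n))) (g.symm (u (pj n)))
    rw [g.apply_symm_apply, g.apply_symm_apply] at h1
    rw [← h1, M, map_add, inv_al g hp, inv_al g hp]
    congr 1
    exact g_om g.toAddMonoidHom hp _
  have hF : ∀ n : Fin 4, bz c'.f n = ∑ k : Fin 4, bz c.f k * alz t n k := by
    intro n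
    have h1 := M_phi τ c' (u n)
    have h2 : g (g.symm (u n) + g.symm (u n) + M τ c (g.symm (u n)) (g.symm (u n))) = u n + u n + M τ c' (u n) (u n) := by
      rw [map_add, map_add, hg, g.apply_symm_apply]
    rw [M_phi, M_phi, fv_u] at h2
    have h3 : fv c.f (g.symm (u n)) = ∑ k : Fin 4, bz c.f k * alz t n k := by
      rw [fv, inv_al g hp]
    rw [h3] at h2
    have hv : ∀ a : ZMod 2, a = 0 ∨ a = 1 := by decide
    cases τ
    · have h4 : ∀ a x, tvc .t8 a x = a.val • tv .t8 := by intro a x; simp only [tvc]; revert a; decide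
      rw [h4, h4, map_nsmul, hgt] at h2
      have h5 : ∀ a b : ZMod 2, a.val • tv .t8 = b.val • tv .t8 → b = a := by decide
      exact h5 _ _ h2
    · have h4 : ∀ a x, tvc .t1 a x = a.val • tv .t1 := by intro a x; simp only [tvc]; revert a; decide
      rw [h4, h4, map_nsmul, hgt] at h2
      have h5 : ∀ a b : ZMod 2, a.val • tv .t1 = b.val • tv .t1 → b = a := by decide
      exact h5 _ _ h2
    · have e1 : c.f = 0 := hc.okf
      have e2 : c'.f = 0 := hc'.okf
      rw [e1, e2]; simp [bz_zero]
  have hep : epT τ ≤ 1 := by cases τ <;> decide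
  have hd0 : d0T τ c.f < 16 := by
    cases τ
    · simp [d0T]
    · exact hc.f16
    · simp [d0T]
  have hd2 : d2T τ c.f < 16 := by
    have := hc.f16
    generalize c.f = f at this
    cases τ
    · simp only [d2T]; revert f; decide
    · simp [d2T]
    · simp [d2T]
  have := act_bits hep t hc.f16 (hc.b64 0) (hc.b64 1) (hc.b64 2) (hc.b64 3) hc'.f16 (hc'.b64 0) (hc'.b64 1) (hc'.b64 2) (hc'.b64 3) hd0 hd2 (by decide : 8 < 16) hF
    (fun n => by
      have := congrFun (hM n) 0
      simp [Fin.sum_univ_four, Wm, Cd.S, ddT] at this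
      rw [this]; ring)
    (fun n => by
      have := congrFun (hM n) 1
      simp [Fin.sum_univ_four, Wm, Cd.S, ddT] at this
      rw [this]; ring)
    (fun n => by
      have := congrFun (hM n) 2
      simp [Fin.sum_univ_four, Wm, Cd.S, ddT] at this
      rw [this]; ring)
    (fun n => by
      have := congrFun (hM n) 3
      simp [Fin.sum_univ_four, Wm, Cd.S, ddT] at this
      rw [this]; ring)
  rw [Cd.act, this.1, this.2.1, this.2.2, Cd.key]
end BR
namespace BR
theorem equiv_ex (t : Th) (hd : Det t) (w2 : A) (hw : nu w2 = ![t.k1, t.k2, t.P, t.Q]) : ∃ g : A ≃+ A, g (u 0) = om ![t.p, t.q, t.x, t.y] ∧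
    g (u 2) = w2 := by
  have hoo : ∀ v, om v + om v = 0 := by intro v; rw [two_om, nu_om]; rfl
  obtain ⟨g, h0, h1, h2, h3⟩ := hom_ex (om ![t.p, t.q, t.x, t.y]) (om ![t.r, t.s, t.z, t.w]) w2 (t.l1, t.l2, inc t.R, inc t.S) (hoo _) (hoo _)
  have hp : Par g t := by
    refine ⟨h0, h1, ?_, ?_⟩
    · rw [h2, hw]
    · rw [h3]; simp [nu, red_inc]
  exact ⟨AddEquiv.ofBijective g (Finite.injective_iff_bijective.1 (par_inj g hp hd)), h0, h2⟩
theorem compl : ∀ a b : ZMod 2, ¬ (a = 0 ∧ b = 0) → ∃ c d, a * d + b * c = 1 := by decide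
theorem orb1 (a b c d : ZMod 2) (h : ¬ (a = 0 ∧ b = 0)) : ∃ g : A ≃+ A, g (u 0) = om ![a, b, c, d] := by
  obtain ⟨r, s, hr⟩ := compl a b h
  obtain ⟨g, h0, h2⟩ := equiv_ex ⟨a, b, r, s, 1, 0, 0, 1, 0, 0, 0, 0, c, d, 0, 0⟩ ⟨hr, by simp⟩ (0, 0, 1, 0) (show nu (0, 0, 1, 0) = ![0, 0, 1, 0] by decide)
  exact ⟨g, h0⟩
theorem orb4 (t : A) (h : ¬ (nu t 2 = 0 ∧ nu t 3 = 0)) : ∃ g : A ≃+ A, g (u 2) = t := by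
  obtain ⟨r, s, hr⟩ := compl _ _ h
  obtain ⟨g, h0, h2⟩ := equiv_ex ⟨1, 0, 0, 1, nu t 2, nu t 3, r, s, t.1, t.2.1, 0, 0, 0, 0, 0, 0⟩ ⟨by simp, hr⟩ t rfl
  exact ⟨g, h2⟩
theorem orbit (t : A) (h : t ≠ 0) : ∃ (τ : Tg) (g : A ≃+ A), g t = tv τ := by
  suffices ∃ (τ : Tg) (g : A ≃+ A), g (tv τ) = t by
    obtain ⟨τ, g, hg⟩ := this
    exact ⟨τ, g.symm, by rw [← hg, g.symm_apply_apply]⟩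
  by_cases h1 : t + t = 0
  · obtain ⟨v, rfl⟩ := om_surj t h1
    by_cases h2 : v 0 = 0 ∧ v 1 = 0
    · have h3 : ¬ (v 2 = 0 ∧ v 3 = 0) := by
        rintro ⟨h3, h4⟩
        exact h (by simp [om, h2.1, h2.2, h3, h4])
      obtain ⟨g, hg⟩ := orb4 (0, 0, inc (v 2), inc (v 3)) (by simpa [nu, red_inc] using h3)
      refine ⟨.t8, g, ?_⟩
      have : tv .t8 = u 2 + u 2 := by decide
      rw [this, map_add, hg, two_om]
      simp [om, nu, red_inc, h2.1, h2.2]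
    · obtain ⟨g, hg⟩ := orb1 (v 0) (v 1) (v 2) (v 3) h2
      exact ⟨.t1, g, hg⟩
  · have h3 : ¬ (nu t 2 = 0 ∧ nu t 3 = 0) := by
      rintro ⟨h3, h4⟩
      exact h1 (by rw [two_om, h3, h4]; rfl)
    obtain ⟨g, hg⟩ := orb4 t h3
    exact ⟨.t4, g, hg⟩
theorem tag_inj {τ τ' : Tg} (g : A ≃+ A) (h : g (tv τ) = tv τ') : τ = τ' := by
  have hs : g.symm (tv τ') = tv τ := by rw [← h, g.symm_apply_apply]
  have n4 : ∀ (τ τ' : Tg) (g : A ≃+ A), g (tv τ) = tv τ' → tv τ + tv τ = 0 → tv τ' + tv τ' = 0 := by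
    intro τ τ' g h h1; rw [← h, ← map_add, h1, map_zero]
  have n8 : ∀ (τ τ' : Tg) (g : A ≃+ A), g (tv τ) = tv τ' → (∃ y, y + y = tv τ) → ∃ y, y + y = tv τ' := by
    rintro τ τ' g h ⟨y, hy⟩; exact ⟨g y, by rw [← map_add, hy, h]⟩
  have a4 := n4 _ _ g h
  have b4 := n4 _ _ g.symm hs
  have a8 := n8 _ _ g h
  have b8 := n8 _ _ g.symm hs
  have f1 : ¬ ∃ y, y + y = tv .t1 := by decide
  have f8 : ∃ y, y + y = tv .t8 := by decide
  have o1 : tv .t1 + tv .t1 = 0 := by decide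
  have o8 : tv .t8 + tv .t8 = 0 := by decide
  have o4 : tv .t4 + tv .t4 ≠ 0 := by decide
  cases τ <;> cases τ' <;> simp_all
theorem good_t {m m' t t'} (h : Good m t) (h' : Good m' t') (g : A ≃+ A) (hg : ∀ x y, g (m x y) = m' (g x) (g y)) : g t = t' := by
  obtain ⟨x, hx⟩ := h.att
  have h1 : g t = g x + g x + m' (g x) (g x) := by rw [← hx, map_add, map_add, hg]
  rcases h'.phi (g x) with h2 | h2
  · rw [h2] at h1
    exact absurd (g.map_eq_zero_iff.1 h1) h.tne
  · rw [h1, h2]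
def trn (m : A → A → A) (g : A ≃+ A) (x y : A) : A := g (m (g.symm x) (g.symm y))
theorem good_trn {m t} (h : Good m t) (g : A ≃+ A) : Good (trn m g) (g t) where
  add_left x y z := by simp only [trn, map_add, h.add_left]
  comm x y := by simp only [trn, h.comm]
  assoc x y z := by simp only [trn, g.symm_apply_apply, h.assoc]
  phi x := by
    have e : x + x + trn m g x x = g (g.symm x + g.symm x + m (g.symm x) (g.symm x)) := by simp [trn]
    rw [e]
    rcases h.phi (g.symm x) with h1 | h1
    · left; rw [h1, map_zero]
    · right; rw [h1]
  att := by
    obtain ⟨x, hx⟩ := h.att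
    exact ⟨g x, by rw [← hx]; simp [trn]⟩
  tne := by simpa using h.tne
  tt := by
    have := congrArg g h.tt
    simpa [trn] using this
theorem trn_hom (m) (g : A ≃+ A) (x y : A) : g (m x y) = trn m g (g x) (g y) := by simp [trn]
structure Cn (τ : Tg) (c : Cd) : Prop where
  ok : c.ok τ
  asc : c.Asc τ
  min : ∀ t, okT τ t → c.key ≤ c.act τ t
theorem mem_EE' (τ : Tg) (z : ℕ) : z ∈ EE τ ↔ ∃ c, Cn τ c ∧ z = c.key := by
  rw [mem_EE]
  constructor
  · rintro ⟨c, h1, h2, h3, h4⟩; exact ⟨c, ⟨h1, h2, h3⟩, h4⟩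
  · rintro ⟨c, ⟨h1, h2, h3⟩, h4⟩; exact ⟨c, h1, h2, h3, h4⟩
theorem Cn_inj {τ τ' c c'} (h : Cn τ c) (h' : Cn τ' c') (g : A ≃+ A) (hg : ∀ x y, g (M τ c x y) = M τ' c' (g x) (g y)) : τ = τ' ∧ c = c' := by
  have ht := good_t (good_M h.ok h.asc) (good_M h'.ok h'.asc) g hg
  obtain rfl := tag_inj g ht
  refine ⟨rfl, key_inj c c' h.ok.b64 h'.ok.b64 ?_⟩
  have hs : g.symm (tv τ) = tv τ := by conv_lhs => rw [← ht, g.symm_apply_apply]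
  have hg' : ∀ x y, g.symm (M τ c' x y) = M τ c (g.symm x) (g.symm y) := by
    intro x y
    rw [g.symm_apply_eq, hg, g.apply_symm_apply, g.apply_symm_apply]
  obtain ⟨t, hp, hok⟩ := F4 g ht
  obtain ⟨t', hp', hok'⟩ := F4 g.symm hs
  apply le_antisymm
  · rw [K h.ok h'.ok g hg ht hp hok]; exact h.min t hok
  · rw [K h'.ok h.ok g.symm hg' hs hp' hok']; exact h'.min t' hok'
theorem Cn_surj {m t} (h : Good m t) : ∃ τ c, Cn τ c ∧ ∃ g : A ≃+ A, ∀ x y, g (m x y) = M τ c (g x) (g y) := by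
  obtain ⟨τ, g0, h0⟩ := orbit t h.tne
  have hG := good_trn h g0
  rw [h0] at hG
  obtain ⟨c0, hc0, ha0, e0⟩ := F2 hG
  classical
  let P : ℕ → Prop := fun k => ∃ c : Cd, c.ok τ ∧ c.Asc τ ∧ c.key = k ∧ ∃ g : A ≃+ A, ∀ x y, g (m x y) = M τ c (g x) (g y)
  have hP : ∃ k, P k := ⟨c0.key, c0, hc0, ha0, rfl, g0, by rw [← e0]; exact trn_hom m g0⟩
  obtain ⟨c, hc, ha, hk, g, hg⟩ := Nat.find_spec hP
  refine ⟨τ, c, ⟨hc, ha, ?_⟩, g, hg⟩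
  intro t ht
  obtain ⟨k, hp, hkt⟩ := F3 ht
  have hG2 := good_trn (good_M hc ha) k
  rw [hkt] at hG2
  obtain ⟨c', hc', ha', e'⟩ := F2 hG2
  have hkk : ∀ x y, k (M τ c x y) = M τ c' (k x) (k y) := by rw [← e']; exact trn_hom _ k
  rw [← K hc hc' k hkk hkt hp ht, hk]
  refine Nat.find_min' hP ⟨c', hc', ha', rfl, g.trans k, ?_⟩
  intro x y
  show k (g (m x y)) = _
  rw [hg, hkk]; rfl
end BR
namespace BR
abbrev Z5 := ZMod 2 × ZMod 2 × ZMod 2 × ZMod 2 × ZMod 4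
theorem grp (G : Type) [AddCommGroup G] (hG : Nat.card G = 64) (t y : G) (ht : t ≠ 0) (hy : y + y = t) (htt : t + t = 0)
    (hp : ∀ x : G, x + x = 0 ∨ x + x = t) : ∃ e : G ≃ Z5, ∀ a b, e (a + b) = e a + e b := by
  have hfin : Finite G := Nat.finite_of_card_ne_zero (by omega)
  let K : AddSubgroup G := (nsmulAddMonoidHom (α := G) 2).ker
  have hK : ∀ x : G, x ∈ K ↔ x + x = 0 := by
    intro x; simp [K, AddMonoidHom.mem_ker, two_nsmul]
  have hK2 : ∀ x : K, 2 • x = 0 := by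
    intro x; ext; have := (hK x).1 x.2; simpa [two_nsmul] using this
  letI : Module (ZMod 2) K := AddCommGroup.zmodModule hK2
  let T : K := ⟨t, (hK t).2 htt⟩
  have hT : T ≠ 0 := by intro h; exact ht (congrArg Subtype.val h)
  obtain ⟨W, hW⟩ := Submodule.exists_isCompl (Submodule.span (ZMod 2) {T})
  have h4y : (4 : ℕ) • y = 0 := by
    have : (4 : ℕ) • y = (y + y) + (y + y) := by abel
    rw [this, hy, htt]
  have h4z : (4 : ℤ) • y = 0 := by rw [← h4y]; exact natCast_zsmul y 4
  let q : ZMod 4 →+ G := ZMod.lift 4 ⟨zmultiplesHom G y, by simpa using h4z⟩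
  have hq : ∀ n : ℤ, q (n : ZMod 4) = n • y := by
    intro n
    have := ZMod.lift_coe 4 (⟨zmultiplesHom G y, by simpa using h4z⟩ : {f : ℤ →+ G // f (4 : ℕ) = 0}) n
    exact this
  have q0 : q 0 = 0 := map_zero q
  have q1 : q 1 = y := by simpa using hq 1
  have q2 : q 2 = t := by
    have : (2 : ZMod 4) = 1 + 1 := by decide
    rw [this, map_add, q1, hy]
  have q3 : q 3 = t + y := by
    have : (3 : ZMod 4) = 2 + 1 := by decide
    rw [this, map_add, q1, q2]
  let f : W × ZMod 4 →+ G := AddMonoidHom.coprod (K.subtype.comp W.subtype.toAddMonoidHom) q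
  have hf : ∀ w n, f (w, n) = ((w : K) : G) + q n := by intro w n; rfl
  have hW2 : ∀ w : W, ((w : K) : G) + ((w : K) : G) = 0 := fun w => (hK _).1 (w : K).2
  have hTW : ∀ w : W, ((w : K) : G) ≠ t := by
    intro w hw
    have h1 : (w : K) = T := Subtype.ext hw
    have h2 : T ∈ W := h1 ▸ w.2
    have := Submodule.disjoint_def.1 hW.disjoint T (Submodule.mem_span_singleton_self T) h2
    exact hT this
  have hinj : Function.Injective f := by
    rw [injective_iff_map_eq_zero]
    rintro ⟨w, n⟩ h
    rw [hf] at h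
    have h2 : q n + q n = 0 := by
      have : (((w : K) : G) + q n) + (((w : K) : G) + q n) = 0 := by rw [h, add_zero]
      rw [add_add_add_comm, hW2, zero_add] at this
      exact this
    have hn : n = 0 ∨ n = 1 ∨ n = 2 ∨ n = 3 := (by decide : ∀ n : ZMod 4, n = 0 ∨ n = 1 ∨ n = 2 ∨ n = 3) n
    rcases hn with rfl | rfl | rfl | rfl
    · rw [q0, add_zero] at h
      have : w = 0 := Subtype.ext (Subtype.ext h)
      rw [this]; rfl
    · rw [q1, hy] at h2; exact absurd h2 ht
    · rw [q2] at h
      have : ((w : K) : G) = t := by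
        rw [← add_zero ((w : K) : G), ← htt, ← add_assoc, h, zero_add]
      exact absurd this (hTW w)
    · rw [q3, add_add_add_comm, htt, zero_add, hy] at h2; exact absurd h2 ht
  have hk : ∀ x : G, x + x = 0 → ∃ p, f p = x := by
    intro x hx
    have hx' : (⟨x, (hK x).2 hx⟩ : K) ∈ Submodule.span (ZMod 2) {T} ⊔ W := by rw [hW.sup_eq_top]; trivial
    obtain ⟨s, hs, w, hw, hsw⟩ := Submodule.mem_sup.1 hx'
    obtain ⟨a, rfl⟩ := Submodule.mem_span_singleton.1 hs
    have ha : a = 0 ∨ a = 1 := (by decide : ∀ a : ZMod 2, a = 0 ∨ a = 1) a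
    rcases ha with rfl | rfl
    · refine ⟨(⟨w, hw⟩, 0), ?_⟩
      rw [hf, q0, add_zero]
      rw [zero_smul, zero_add] at hsw
      exact congrArg Subtype.val hsw
    · refine ⟨(⟨w, hw⟩, 2), ?_⟩
      rw [hf, q2, add_comm]
      rw [one_smul] at hsw
      exact congrArg Subtype.val hsw
  have hsurj : Function.Surjective f := by
    intro x
    rcases hp x with h | h
    · exact hk x h
    · obtain ⟨p, hp⟩ := hk (x + y) (by rw [add_add_add_comm, h, hy, htt])
      refine ⟨p + (0, 3), ?_⟩
      rw [map_add, hp, hf, q3]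
      have : x + y + (((0 : W) : K) + (t + y)) = x + ((y + y) + t) := by simp; abel
      rw [this, hy, htt, add_zero]
  let F : W × ZMod 4 ≃+ G := AddEquiv.ofBijective f ⟨hinj, hsurj⟩
  have hcard : Nat.card W = 16 := by
    have := Nat.card_congr F.toEquiv
    rw [Nat.card_prod, hG, Nat.card_zmod] at this
    omega
  have hfr : Module.finrank (ZMod 2) W = 4 := by
    have := Module.natCard_eq_pow_finrank (K := ZMod 2) (V := W)
    rw [hcard, Nat.card_zmod] at this
    exact Nat.pow_right_injective (le_refl 2) (by simpa using this.symm)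
  let b := Module.finBasisOfFinrankEq (ZMod 2) W hfr
  let J : (Fin 4 → ZMod 2) × ZMod 4 ≃+ G := ((b.equivFun.symm.toAddEquiv).prodCongr (AddEquiv.refl _)).trans F
  let e : (Fin 4 → ZMod 2) × ZMod 4 ≃ Z5 :=
    { toFun := fun p => (p.1 0, p.1 1, p.1 2, p.1 3, p.2)
      invFun := fun z => (![z.1, z.2.1, z.2.2.1, z.2.2.2.1], z.2.2.2.2)
      left_inv := by
        rintro ⟨v, n⟩; simp only [Prod.mk.injEq, and_true]
        funext i; fin_cases i <;> rfl
      right_inv := by rintro ⟨a, b, c, d, n⟩; rfl }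
  refine ⟨J.symm.toEquiv.trans e, fun a b => ?_⟩
  show e (J.symm (a + b)) = e (J.symm a) + e (J.symm b)
  rw [map_add]; rfl
structure Ci {m : A → A → A} {t : A} (h : Good m t) where
  v : A
theorem Good.cassoc {m t} (h : Good m t) (x y z : A) : (x + y + m x y) + z + m (x + y + m x y) z = x + (y + z + m y z) + m x (y + z + m y z) := by
  simp only [h.add_left, h.add_right, h.assoc]; abel
theorem Good.quad {m t} (h : Good m t) (x : A) : (x + x + m x x) + (x + x + m x x) + m (x + x + m x x) (x + x + m x x) = 0 := by
  rcases h.phi x with h1 | h1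
  · rw [h1, h.zero_left]; rfl
  · rw [h1, h.tt]
def cng (m : A → A → A) (x : A) : A := x + (x + x + m x x) + m x (x + x + m x x)
theorem Good.cneg {m t} (h : Good m t) (x : A) : cng m x + x + m (cng m x) x = 0 := by
  have h1 := h.cassoc x x (x + x + m x x)
  rw [h.quad] at h1
  rw [h.comm (cng m x) x, cng, add_comm (x + (x + x + m x x) + m x (x + x + m x x)) x]
  exact h1.symm
instance {m t} (h : Good m t) : Add (Ci h) := ⟨fun x y => ⟨x.v + y.v + m x.v y.v⟩⟩
instance {m t} (h : Good m t) : Zero (Ci h) := ⟨⟨0⟩⟩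
instance {m t} (h : Good m t) : Neg (Ci h) := ⟨fun x => ⟨cng m x.v⟩⟩
instance {m t} (h : Good m t) : AddCommGroup (Ci h) where
  add_assoc x y z := congrArg Ci.mk (h.cassoc x.v y.v z.v)
  zero_add x := congrArg Ci.mk (show 0 + x.v + m 0 x.v = x.v by rw [h.zero_left, zero_add, add_zero])
  add_zero x := congrArg Ci.mk (show x.v + 0 + m x.v 0 = x.v by rw [h.zero_right, add_zero, add_zero])
  neg_add_cancel x := congrArg Ci.mk (h.cneg x.v)
  add_comm x y := congrArg Ci.mk (show x.v + y.v + m x.v y.v = y.v + x.v + m y.v x.v by rw [h.comm, add_comm x.v])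
  nsmul := nsmulRec
  zsmul := zsmulRec
theorem Good.mulIso {m t} (h : Good m t) : ∃ e : A ≃ Z5, ∀ x y, e (x + y + m x y) = e x + e y := by
  let E : A ≃ Ci h := ⟨Ci.mk, Ci.v, fun _ => rfl, fun _ => rfl⟩
  obtain ⟨y, hy⟩ := h.att
  obtain ⟨e, he⟩ := grp (Ci h) (by rw [← Nat.card_congr E]; simp [A]) ⟨t⟩ ⟨y⟩ (fun hh => h.tne (congrArg Ci.v hh)) (congrArg Ci.mk hy)
    (congrArg Ci.mk h.tt) (fun x => (h.phi x.v).imp (congrArg Ci.mk) (congrArg Ci.mk))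
  exact ⟨E.trans e, fun x y => he ⟨x⟩ ⟨y⟩⟩
end BR
namespace BR
def mm {B : Type} (L : LeftBrace B) (a : B ≃ A) (x y : A) : A := a (L.mul (a.symm x) (a.symm y)) - x - y
theorem mm_mul {B : Type} (L : LeftBrace B) (a : B ≃ A) (x y : B) : a (L.mul x y) = a x + a y + mm L a (a x) (a y) := by
  simp only [mm, a.symm_apply_apply]; abel
theorem good_mm {B : Type} (L : LeftBrace B) (a : B ≃ A) (ha : ∀ x y, a (L.add x y) = a x + a y) (e : B ≃ Z5) (he : ∀ x y, e (L.mul x y) = e x + e y) :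
    Good (mm L a) (a (e.symm (0, 0, 0, 0, 2))) := by
  have hz : a L.zero = 0 := by
    have := ha L.zero L.zero
    rw [L.zero_add] at this
    simpa using this
  have hn : ∀ x, a (L.neg x) = - a x := by
    intro x
    have := ha (L.neg x) x
    rw [L.neg_add_cancel, hz] at this
    exact eq_neg_of_add_eq_zero_left this.symm
  have hc : ∀ x y, L.mul x y = L.mul y x := by
    intro x y; apply e.injective; rw [he, he, add_comm]
  have hcm : ∀ x y, mm L a x y = mm L a y x := by
    intro x y; simp only [mm]; rw [hc]; abel
  have hr : ∀ x y z, mm L a x (y + z) = mm L a x y + mm L a x z := by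
    intro x y z
    have h1 := congrArg a (L.brace (a.symm x) (a.symm y) (a.symm z))
    have h2 : L.add (a.symm y) (a.symm z) = a.symm (y + z) := by
      apply a.injective; rw [ha]; simp
    rw [h2, ha, ha, hn, a.apply_symm_apply] at h1
    simp only [mm, h1]; abel
  have hl : ∀ x y z, mm L a (x + y) z = mm L a x z + mm L a y z := by
    intro x y z; rw [hcm, hr, hcm z, hcm z]
  have hphi : ∀ x, x + x + mm L a x x = a (e.symm (e (a.symm x) + e (a.symm x))) := by
    intro x
    rw [← he, e.symm_apply_apply]; simp only [mm]; abel
  have h0 : a (e.symm 0) = 0 := by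
    have h1 : e L.one = 0 := by
      have := he L.one L.one
      rw [L.one_mul] at this
      simpa using this
    have h3 := L.brace L.one L.zero L.zero
    rw [L.zero_add, L.one_mul, ← h1, e.symm_apply_apply] at *
    have h4 := congrArg a h3
    rw [ha, ha, hn, hz] at h4
    simpa using h4
  have hd : ∀ z : Z5, z + z = 0 ∨ z + z = (0, 0, 0, 0, 2) := by decide
  refine ⟨hl, hcm, ?_, ?_, ?_, ?_, ?_⟩
  · intro x y z
    have h1 := congrArg a (L.mul_assoc (a.symm x) (a.symm y) (a.symm z))
    simp only [mm_mul, a.apply_symm_apply, hl, hr] at h1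
    have h2 : ∀ p q s r1 r2 r3 r4 r5 : A, p + q + r1 + s + (r2 + r3 + r4) = p + (q + s + r3) + (r1 + r2 + r5) → r4 = r5 := by
      intro p q s r1 r2 r3 r4 r5 h
      have : p + q + r1 + s + (r2 + r3 + r4) = (p + q + r1 + s + r2 + r3) + r4 := by abel
      rw [this] at h
      have : p + (q + s + r3) + (r1 + r2 + r5) = (p + q + r1 + s + r2 + r3) + r5 := by abel
      rw [this] at h
      exact add_left_cancel h
    exact h2 _ _ _ _ _ _ _ _ h1
  · intro x
    rw [hphi]
    rcases hd (e (a.symm x)) with h | h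
    · left; rw [h, h0]
    · right; rw [h]
  · refine ⟨a (e.symm (0, 0, 0, 0, 1)), ?_⟩
    rw [hphi, a.symm_apply_apply, e.apply_symm_apply]; rfl
  · intro h
    have := e.symm.injective (a.injective (h.trans h0.symm))
    exact absurd this (by decide)
  · rw [hphi, a.symm_apply_apply, e.apply_symm_apply]
    exact h0
theorem card_A : Fintype.card A = 64 := by simp [A, Fintype.card_prod, ZMod.card]
noncomputable def sg : Fin 64 ≃ A := (Fintype.equivFinOfCardEq card_A).symm
noncomputable def ofM {m t} (h : Good m t) : LeftBrace (Fin 64) where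
  add x y := sg.symm (sg x + sg y)
  zero := sg.symm 0
  neg x := sg.symm (- sg x)
  mul x y := sg.symm (sg x + sg y + m (sg x) (sg y))
  one := sg.symm 0
  inv x := sg.symm (cng m (sg x))
  add_assoc a b c := by simp [add_assoc]
  add_comm a b := by rw [add_comm]
  zero_add a := by simp
  neg_add_cancel a := by simp
  mul_assoc a b c := by simp only [Equiv.apply_symm_apply, h.cassoc]
  one_mul a := by simp [h.zero_left]
  mul_one a := by simp [h.zero_right]
  inv_mul_cancel a := by simp only [Equiv.apply_symm_apply, h.cneg]
  brace x y z := by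
    simp only [Equiv.apply_symm_apply, h.add_right]
    congr 1; abel
theorem ofM_add {m t} (h : Good m t) (x y) : sg ((ofM h).add x y) = sg x + sg y := by simp [ofM]
theorem ofM_mul {m t} (h : Good m t) (x y) : sg ((ofM h).mul x y) = sg x + sg y + m (sg x) (sg y) := by simp [ofM]
theorem ofM_addIso {m t} (h : Good m t) : (ofM h).AddIso A := ⟨sg, ofM_add h⟩
theorem ofM_mulIso {m t} (h : Good m t) : (ofM h).MulIso Z5 := by
  obtain ⟨e, he⟩ := h.mulIso
  exact ⟨sg.trans e, fun x y => by
    show e (sg ((ofM h).mul x y)) = _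
    rw [ofM_mul, he]; rfl⟩
abbrev Br := {L : LeftBrace (Fin 64) // L.AddIso A ∧ L.MulIso Z5}
def rel (L₁ L₂ : Br) : Prop := L₁.1.Iso L₂.1
theorem rel_equiv : Equivalence rel where
  refl L := ⟨Equiv.refl _, fun _ _ => rfl, fun _ _ => rfl⟩
  symm := by
    rintro L L' ⟨e, h1, h2⟩
    refine ⟨e.symm, fun x y => ?_, fun x y => ?_⟩
    · rw [Equiv.symm_apply_eq, h1]; simp
    · rw [Equiv.symm_apply_eq, h2]; simp
  trans := by
    rintro L L' L'' ⟨e, h1, h2⟩ ⟨e', h1', h2'⟩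
    exact ⟨e.trans e', fun x y => by simp [h1, h1'], fun x y => by simp [h2, h2']⟩
abbrev Ix := Σ τ : Tg, {c : Cd // Cn τ c}
theorem Ix.good (i : Ix) : Good (M i.1 i.2.1) (tv i.1) := good_M i.2.2.ok i.2.2.asc
noncomputable def Phi (i : Ix) : Quot rel := Quot.mk rel ⟨ofM i.good, ofM_addIso i.good, ofM_mulIso i.good⟩
theorem Phi_inj : Function.Injective Phi := by
  intro i j h
  have h1 := (rel_equiv.eqvGen_iff).1 (Quot.eqvGen_exact h)
  obtain ⟨e, ha, hm⟩ := h1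
  let g : A ≃+ A :=
    { toEquiv := (sg.symm.trans e).trans sg
      map_add' := by
        intro x y
        have := congrArg sg (ha (sg.symm x) (sg.symm y))
        rw [ofM_add] at this
        have h2 : (ofM i.good).add (sg.symm x) (sg.symm y) = sg.symm (x + y) := by
          apply sg.injective; rw [ofM_add]; simp
        rw [h2] at this
        exact this }
  have hg : ∀ x, g x = sg (e (sg.symm x)) := fun _ => rfl
  have key : ∀ x y, g (M i.1 i.2.1 x y) = M j.1 j.2.1 (g x) (g y) := by
    intro x y
    have := congrArg sg (hm (sg.symm x) (sg.symm y))
    rw [ofM_mul] at this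
    have h2 : (ofM i.good).mul (sg.symm x) (sg.symm y) = sg.symm (x + y + M i.1 i.2.1 x y) := by
      apply sg.injective; rw [ofM_mul]; simp
    rw [h2, ← hg, ← hg, ← hg, map_add, map_add] at this
    exact add_left_cancel this
  obtain ⟨τ, c, hc⟩ := i
  obtain ⟨τ', c', hc'⟩ := j
  obtain ⟨h3, h4⟩ := Cn_inj hc hc' g key
  subst h3; subst h4; rfl
theorem Phi_surj : Function.Surjective Phi := by
  intro q
  induction q using Quot.ind with
  | mk L =>
    obtain ⟨L, ⟨a, ha⟩, ⟨e, he⟩⟩ := L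
    obtain ⟨τ, c, hc, g, hg⟩ := Cn_surj (good_mm L a ha e he)
    refine ⟨⟨τ, c, hc⟩, ?_⟩
    refine Quot.sound (rel_equiv.symm ?_)
    refine ⟨(a.trans g.toEquiv).trans sg.symm, fun x y => ?_, fun x y => ?_⟩
    · apply sg.injective
      rw [ofM_add]
      simp [ha]
    · apply sg.injective
      rw [ofM_mul]
      simp [mm_mul, hg]
theorem cks_ok (l : List ℕ) : ∀ last c : ℕ, cks l last c < 100000 → (l.Pairwise (· < ·) ∧ (∀ x ∈ l, last < x) ∧ cks l last c = c + l.length) := by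
  induction l with
  | nil => intro last c _; exact ⟨List.Pairwise.nil, by simp, rfl⟩
  | cons a l ih =>
    intro last c h
    have e : cks (a :: l) last c = frc a fun a => cnd (Nat.blt last a) (frc (Nat.succ c) fun c => cks l a c) 100000 := rfl
    simp only [frc_eq] at e
    rw [e] at h ⊢
    cases hb : Nat.blt last a with
    | false => rw [hb] at h; exact absurd h (lt_irrefl 100000)
    | true =>
      rw [hb] at h
      obtain ⟨h1, h2, h3⟩ := ih a (Nat.succ c) h
      have hb' : last < a := by simpa [Nat.blt] using hb
      refine ⟨List.pairwise_cons.2 ⟨h2, h1⟩, ?_, ?_⟩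
      · intro x hx
        rcases List.mem_cons.1 hx with rfl | hx
        · exact hb'
        · exact hb'.trans (h2 x hx)
      · show cks l a (Nat.succ c) = _
        rw [h3, List.length_cons]; omega
set_option maxRecDepth 100000 in
theorem cks4 : cks e4 0 0 = 13 := by decide +kernel
set_option maxRecDepth 100000 in
theorem cks1 : cks e1 0 0 = 243 := by decide +kernel
set_option maxRecDepth 100000 in
theorem cks8 : cks e8 0 0 = 722 := by decide +kernel
theorem card_Cn (τ : Tg) {n : ℕ} (hn : cks (EE τ) 0 0 = n) (hlt : n < 100000) : Nat.card {c : Cd // Cn τ c} = n := by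
  obtain ⟨h1, _, h3⟩ := cks_ok (EE τ) 0 0 (by rw [hn]; exact hlt)
  have hnd : (EE τ).Nodup := h1.imp (fun h => ne_of_lt h)
  have e : {c : Cd // Cn τ c} ≃ {z // z ∈ (EE τ).toFinset} := by
    refine Equiv.ofBijective (fun c => ⟨c.1.key, by rw [List.mem_toFinset, mem_EE']; exact ⟨c.1, c.2, rfl⟩⟩) ⟨?_, ?_⟩
    · intro c c' h
      exact Subtype.ext (key_inj _ _ c.2.ok.b64 c'.2.ok.b64 (congrArg Subtype.val h))
    · rintro ⟨z, hz⟩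
      rw [List.mem_toFinset, mem_EE'] at hz
      obtain ⟨c, hc, rfl⟩ := hz
      exact ⟨⟨c, hc⟩, rfl⟩
  rw [Nat.card_congr e, Nat.card_eq_fintype_card, Fintype.card_coe, List.toFinset_card_of_nodup hnd]
  rw [hn] at h3; omega
def Tgf : Tg ≃ Fin 3 where
  toFun | .t8 => 0 | .t1 => 1 | .t4 => 2
  invFun := ![.t8, .t1, .t4]
  left_inv := by intro τ; cases τ <;> rfl
  right_inv := by intro i; fin_cases i <;> rfl
theorem card_Ix : Nat.card Ix = 978 := by
  have c8 := card_Cn .t8 cks8 (by omega)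
  have c1 := card_Cn .t1 cks1 (by omega)
  have c4 := card_Cn .t4 cks4 (by omega)
  have hf : ∀ τ, Finite {c : Cd // Cn τ c} := by
    intro τ
    apply Nat.finite_of_card_ne_zero
    cases τ
    · rw [c8]; omega
    · rw [c1]; omega
    · rw [c4]; omega
  have e : Ix ≃ Σ i : Fin 3, {c : Cd // Cn (Tgf.symm i) c} := (Equiv.sigmaCongrLeft (β := fun τ => {c : Cd // Cn τ c}) Tgf.symm).symm
  rw [Nat.card_congr e, Nat.card_sigma, Fin.sum_univ_three]
  have : Nat.card {c : Cd // Cn (Tgf.symm 0) c} = 722 := c8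
  have : Nat.card {c : Cd // Cn (Tgf.symm 1) c} = 243 := c1
  have : Nat.card {c : Cd // Cn (Tgf.symm 2) c} = 13 := c4
  omega
theorem card_Q : Nat.card (Quot rel) = 978 := by
  rw [← card_Ix]
  exact (Nat.card_congr (Equiv.ofBijective Phi ⟨Phi_inj, Phi_surj⟩)).symm
end BR
/-- The number of isomorphism classes of left braces with additive group
isomorphic to `C₂ × C₂ × C₄ × C₄` and multiplicative group isomorphic to
`C₂ × C₂ × C₂ × C₂ × C₄` is `978`. -/
theorem number_of_braces_by_mul_group :
    Nat.card (Quot (fun (L₁ L₂ : {L : LeftBrace (Fin 64) //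
        L.AddIso (ZMod 2 × ZMod 2 × ZMod 4 × ZMod 4) ∧
        L.MulIso (ZMod 2 × ZMod 2 × ZMod 2 × ZMod 2 × ZMod 4)}) => L₁.1.Iso L₂.1)) = 978 := by
  exact BR.card_Q
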